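/- arXiv:1603.08171 — 4 statements merged into one kernel-verified Lean document; each statement's English description precedes it below -/
import Mathlib

section
/- Let N, m ≥ 1. There is a constant c = c(N, m) ≥ 1 such that for all nonempty disjoint compact convex sets E, F ⊆ ℝᴺ, c^{−1} d(E,F) ≤ sup_{φ ∈ E_m(ℝᴺ)} ( inf_{x ∈ E} φ(x) − sup_{y ∈ F} φ(y) ) ≤ c · d(E,F), where d(E,F) = inf{|x−y| : x ∈ E, y ∈ F} is the Euclidean distance between E and F. -/
open MeasureTheory Metric Set
open scoped ENNReal NNReal

/-- The Euclidean distance between two sets,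
`d(E,F) = inf {|x - y| : x ∈ E, y ∈ F}` (with the convention `sInf ∅ = 0`). -/
noncomputable def setDist {α : Type*} [PseudoMetricSpace α] (E F : Set α) : ℝ :=
  sInf (Set.image2 dist E F)

/-- `E_m(ℝᴺ)`: the class of bounded smooth real-valued functions on `ℝᴺ` whose
iterated (total) derivatives of every order `k` with `1 ≤ k ≤ m` are bounded
by `1`. -/
def EmClass (N m : ℕ) : Set (EuclideanSpace ℝ (Fin N) → ℝ) :=
  {φ | ContDiff ℝ (⊤ : ℕ∞) φ ∧ (∃ M : ℝ, ∀ x, |φ x| ≤ M) ∧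
    ∀ k : ℕ, 1 ≤ k → k ≤ m → ∀ x, ‖iteratedFDeriv ℝ k φ x‖ ≤ 1}

open scoped Pointwise RealInnerProductSpace

/-- The ridge function `x ↦ L * sin (⟪u, x⟫ / L)` has all derivatives of positive order bounded by
`1` when `‖u‖ ≤ 1 ≤ L`. -/
lemma ridge_sin_mem_EmClass {N : ℕ} (m : ℕ) {u : EuclideanSpace ℝ (Fin N)} (hu : ‖u‖ ≤ 1)
    {L : ℝ} (hL : 1 ≤ L) : (fun x => L * Real.sin (⟪u, x⟫ / L)) ∈ EmClass N m := by
  have hL0 : 0 < L := by linarith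
  set g : EuclideanSpace ℝ (Fin N) →L[ℝ] ℝ := L⁻¹ • innerSL ℝ u with hg
  have hgn : ‖g‖ ≤ L⁻¹ := by
    rw [hg, norm_smul, innerSL_apply_norm, Real.norm_of_nonneg (by positivity)]
    exact mul_le_of_le_one_right (by positivity) hu
  have heq : (fun x => L * Real.sin (⟪u, x⟫ / L)) = L • (Real.sin ∘ g) := by
    funext x
    simp [hg, div_eq_inv_mul]
  have hsin : ContDiff ℝ (⊤ : ℕ∞) (Real.sin ∘ g) := Real.contDiff_sin.comp g.contDiff
  rw [heq]
  refine ⟨hsin.const_smul L, ⟨L, fun x => ?_⟩, fun k hk _ x => ?_⟩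
  · simpa [abs_mul, abs_of_pos hL0] using
      mul_le_of_le_one_right hL0.le (Real.abs_sin_le_one (g x))
  · have hk' : ContDiff ℝ k (Real.sin ∘ g) := Real.contDiff_sin.comp g.contDiff
    rw [iteratedFDeriv_const_smul_apply hk'.contDiffAt, norm_smul, Real.norm_of_nonneg hL0.le,
      g.iteratedFDeriv_comp_right (Real.contDiff_sin (n := k)) x le_rfl]
    have h1 := (iteratedFDeriv ℝ k Real.sin (g x)).norm_compContinuousLinearMap_le fun _ => g
    rw [norm_iteratedFDeriv_eq_norm_iteratedDeriv, Finset.prod_const, Finset.card_univ,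
      Fintype.card_fin] at h1
    have h2 : ‖g‖ ^ k ≤ L⁻¹ := calc
      ‖g‖ ^ k ≤ ‖g‖ ^ 1 := pow_le_pow_of_le_one (norm_nonneg _)
        (hgn.trans (inv_le_one_of_one_le₀ hL)) hk
      _ ≤ L⁻¹ := by simpa using hgn
    calc _ ≤ L * (1 * L⁻¹) := by
          gcongr
          exact h1.trans (mul_le_mul (Real.abs_iteratedDeriv_sin_le_one k _) h2
            (by positivity) zero_le_one)
      _ = 1 := by field_simp

lemma half_sub_le_sin_sub_sin {a b : ℝ} (ha : -1 ≤ a) (hab : a ≤ b) (hb : b ≤ 1) :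
    (b - a) / 2 ≤ Real.sin b - Real.sin a := by
  have h := (convex_Icc (-1 : ℝ) 1).mul_sub_le_image_sub_of_le_deriv (f := Real.sin) (C := 1 / 2)
    Real.continuous_sin.continuousOn Real.differentiable_sin.differentiableOn
    (fun x hx => by
      rw [interior_Icc] at hx
      rw [Real.deriv_sin]
      have := Real.one_sub_sq_div_two_le_cos (x := x)
      nlinarith [hx.1, hx.2])
    a ⟨ha, hab.trans hb⟩ b ⟨ha.trans hab, hb⟩ hab
  linarith

/-- Two nonempty compact convex sets have a closest pair of points, and the vector joining these
points separates the sets. -/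
lemma exists_closest_pair_separating {V : Type*} [NormedAddCommGroup V] [InnerProductSpace ℝ V]
    {E F : Set V} (hE : E.Nonempty) (hF : F.Nonempty) (hEc : IsCompact E) (hFc : IsCompact F)
    (hEx : Convex ℝ E) (hFx : Convex ℝ F) :
    ∃ p ∈ E, ∃ q ∈ F, setDist E F = dist p q ∧
      ∀ x ∈ E, ∀ y ∈ F, ‖p - q‖ ^ 2 ≤ ⟪p - q, x - y⟫ := by
  obtain ⟨⟨p, q⟩, ⟨hp, hq⟩, hmin⟩ := (hEc.prod hFc).exists_isMinOn (hE.prod hF)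
    (f := fun z => dist z.1 z.2) continuous_dist.continuousOn
  have hmin' : ∀ x ∈ E, ∀ y ∈ F, dist p q ≤ dist x y := fun x hx y hy =>
    hmin (show (x, y) ∈ E ×ˢ F from ⟨hx, hy⟩)
  refine ⟨p, hp, q, hq, IsLeast.csInf_eq ⟨mem_image2_of_mem hp hq, ?_⟩, fun x hx y hy => ?_⟩
  · rintro _ ⟨x, hx, y, hy, rfl⟩
    exact hmin' x hx y hy
  · have hK : p - q ∈ E - F := sub_mem_sub hp hq
    have : Nonempty ↥(E - F) := ⟨⟨_, hK⟩⟩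
    have hinf : ‖(0 : V) - (p - q)‖ = ⨅ w : ↥(E - F), ‖(0 : V) - w‖ := by
      refine le_antisymm (le_ciInf ?_)
        (ciInf_le ⟨0, by rintro _ ⟨w, rfl⟩; exact norm_nonneg _⟩ (⟨p - q, hK⟩ : ↥(E - F)))
      rintro ⟨_, a, ha, b, hb, rfl⟩
      simpa only [zero_sub, norm_neg, dist_eq_norm] using hmin' a ha b hb
    have h := (norm_eq_iInf_iff_real_inner_le_zero (hEx.sub hFx) hK).1 hinf _ (sub_mem_sub hx hy)
    rw [zero_sub, inner_neg_left, inner_sub_right, real_inner_self_eq_norm_sq] at h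
    linarith

/-- Davies' comparison (2.5): there is `c = c(N,m) ≥ 1` such that
for all nonempty disjoint compact convex `E, F ⊆ ℝᴺ`,
`c⁻¹ d(E,F) ≤ sup_{φ ∈ E_m} (inf_E φ - sup_F φ) ≤ c d(E,F)`. -/
theorem stmt_7 (N m : ℕ) (hN : 1 ≤ N) (hm : 1 ≤ m) :
    ∃ c : ℝ, 1 ≤ c ∧
      ∀ E F : Set (EuclideanSpace ℝ (Fin N)),
        E.Nonempty → F.Nonempty → Disjoint E F → IsCompact E → IsCompact F →
        Convex ℝ E → Convex ℝ F →
        c⁻¹ * setDist E F ≤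
            sSup ((fun φ => sInf (φ '' E) - sSup (φ '' F)) '' EmClass N m) ∧
          sSup ((fun φ => sInf (φ '' E) - sSup (φ '' F)) '' EmClass N m) ≤
            c * setDist E F := by
  refine ⟨2, one_le_two, fun E F hE hF hdisj hEc hFc hEx hFx => ?_⟩
  obtain ⟨p, hp, q, hq, hd, hsep⟩ := exists_closest_pair_separating hE hF hEc hFc hEx hFx
  have hpq : p ≠ q := fun h => hdisj.ne_of_mem hp hq h
  have hnorm : 0 < ‖p - q‖ := norm_pos_iff.2 (sub_ne_zero.2 hpq)
  have hupper : ∀ φ ∈ EmClass N m, sInf (φ '' E) - sSup (φ '' F) ≤ dist p q := by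
    rintro φ ⟨hsmooth, ⟨M, hM⟩, hder⟩
    have h1 : sInf (φ '' E) ≤ φ p := csInf_le
      ⟨-M, by rintro _ ⟨x, -, rfl⟩; exact (abs_le.1 (hM x)).1⟩ (mem_image_of_mem φ hp)
    have h2 : φ q ≤ sSup (φ '' F) := le_csSup
      ⟨M, by rintro _ ⟨x, -, rfl⟩; exact (abs_le.1 (hM x)).2⟩ (mem_image_of_mem φ hq)
    have h3 : ‖φ p - φ q‖ ≤ 1 * ‖p - q‖ := convex_univ.norm_image_sub_le_of_norm_fderiv_le
      (fun x _ => hsmooth.differentiable (by simp) x)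
      (fun x _ => by simpa only [norm_iteratedFDeriv_one] using hder 1 le_rfl hm x)
      (mem_univ q) (mem_univ p)
    rw [dist_eq_norm]
    linarith [le_abs_self (φ p - φ q), Real.norm_eq_abs (φ p - φ q)]
  rw [hd]
  constructor
  · obtain ⟨R, hR⟩ := (hEc.union hFc).isBounded.exists_norm_le
    set L : ℝ := max 1 R
    have hL : 1 ≤ L := le_max_left _ _
    have hL0 : 0 < L := by linarith
    set u := ‖p - q‖⁻¹ • (p - q) with hu
    have hu1 : ‖u‖ = 1 := norm_smul_inv_norm (𝕜 := ℝ) (sub_ne_zero.2 hpq)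
    have hmem := ridge_sin_mem_EmClass m hu1.le hL
    set φ : EuclideanSpace ℝ (Fin N) → ℝ := fun x => L * Real.sin (⟪u, x⟫ / L)
    have hbound : ∀ x ∈ E ∪ F, |⟪u, x⟫ / L| ≤ 1 := fun x hx => by
      rw [abs_div, abs_of_pos hL0, div_le_one hL0]
      calc |⟪u, x⟫| ≤ ‖u‖ * ‖x‖ := abs_real_inner_le_norm u x
        _ ≤ L := by rw [hu1, one_mul]; exact (hR x hx).trans (le_max_right _ _)
    have hgap : ∀ x ∈ E, ∀ y ∈ F, φ y + 2⁻¹ * dist p q ≤ φ x := fun x hx y hy => by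
      have h1 : ‖p - q‖ ≤ ⟪u, x⟫ - ⟪u, y⟫ := by
        rw [← inner_sub_right, hu, real_inner_smul_left, ← div_eq_inv_mul, le_div_iff₀ hnorm,
          ← sq]
        exact hsep x hx y hy
      have h2 := half_sub_le_sin_sub_sin (abs_le.1 (hbound y (.inr hy))).1
        (div_le_div_of_nonneg_right (by linarith) hL0.le) (abs_le.1 (hbound x (.inl hx))).2
      have h3 := mul_le_mul_of_nonneg_left h2 hL0.le
      have h4 : L * ((⟪u, x⟫ / L - ⟪u, y⟫ / L) / 2) = (⟪u, x⟫ - ⟪u, y⟫) / 2 := by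
        field_simp
      rw [dist_eq_norm]
      simp only [φ]
      linarith
    have hsup : sSup (φ '' F) ≤ sInf (φ '' E) - 2⁻¹ * dist p q := by
      refine csSup_le (hF.image φ) ?_
      rintro _ ⟨y, hy, rfl⟩
      refine le_sub_iff_add_le.2 (le_csInf (hE.image φ) ?_)
      rintro _ ⟨x, hx, rfl⟩
      exact hgap x hx y hy
    refine le_trans (by linarith : 2⁻¹ * dist p q ≤ sInf (φ '' E) - sSup (φ '' F))
      (le_csSup ⟨dist p q, ?_⟩ (mem_image_of_mem _ hmem))
    rintro _ ⟨ψ, hψ, rfl⟩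
    exact hupper ψ hψ
  · refine Real.sSup_le ?_ (by positivity)
    rintro _ ⟨ψ, hψ, rfl⟩
    linarith [hupper ψ hψ, dist_nonneg (x := p) (y := q)]
end

section
/- Let m ≥ 1 and N > 2m. There exists a constant C = C(m, N) > 0 such that for every measurable function V : ℝᴺ → ℝ with finite weak L^{N/(2m)} quasinorm and every f ∈ C_c^∞(ℝᴺ; ℂ), ∫_{ℝᴺ} |V(x)| |f(x)|² dx ≤ C ‖V‖_{L^{N/(2m),∞}} ‖∇^m f‖_{L²(ℝᴺ)}². -/
open MeasureTheory
open scoped ENNReal NNReal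

/-- The weak `L^r` quasinorm
`‖g‖_{L^{r,∞}} = sup_{γ>0} γ |{x : |g x| > γ}|^{1/r}`, valued in `ℝ≥0∞`. -/
noncomputable def weakLpNorm {α : Type*} [MeasurableSpace α]
    (μ : Measure α) (r : ℝ) (g : α → ℝ) : ℝ≥0∞ :=
  ⨆ (γ : ℝ) (_ : 0 < γ), ENNReal.ofReal γ * μ {x | γ < |g x|} ^ (1 / r)

open Set Real FourierTransform SchwartzMap LineDeriv

theorem lintegral_Ioi_ofReal_rpow {a c : ℝ} (ha : a < -1) (hc : 0 < c) :
    ∫⁻ t in Ioi c, ENNReal.ofReal (t ^ a) = ENNReal.ofReal (-c ^ (a + 1) / (a + 1)) := by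
  rw [← integral_Ioi_rpow_of_lt ha hc,
    ofReal_integral_eq_lintegral_ofReal (integrableOn_Ioi_rpow_of_lt ha hc)]
  filter_upwards [ae_restrict_mem measurableSet_Ioi] with t ht
  exact rpow_nonneg (hc.trans ht).le _

theorem norm_pow_two_mul_le_sum_inner_pow {E ι : Type*} [NormedAddCommGroup E]
    [InnerProductSpace ℝ E] [Fintype ι] (b : OrthonormalBasis ι ℝ E) (n : ℕ) (ξ : E) :
    ‖ξ‖ ^ (2 * (n + 1)) ≤ Fintype.card ι ^ n * ∑ i, |inner ℝ ξ (b i)| ^ (2 * (n + 1)) := by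
  have := pow_sum_le_card_mul_sum_pow (s := Finset.univ) (f := fun i => inner ℝ ξ (b i) ^ 2)
    (fun i _ => sq_nonneg _) n
  rw [b.sum_sq_inner_left] at this
  simpa only [pow_mul, sq_abs, Finset.card_univ] using this

section Fourier

variable {E : Type*} [NormedAddCommGroup E] [InnerProductSpace ℝ E] [FiniteDimensional ℝ E]
  [MeasurableSpace E] [BorelSpace E]

/-- Plancherel's theorem for Schwartz functions, in terms of lower Lebesgue integrals. -/
theorem SchwartzMap.lintegral_enorm_sq_fourier (φ : 𝓢(E, ℂ)) :
    ∫⁻ ξ, ‖𝓕 φ ξ‖ₑ ^ 2 = ∫⁻ x, ‖φ x‖ₑ ^ 2 := by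
  have key (ψ : 𝓢(E, ℂ)) : ∫⁻ x, ‖ψ x‖ₑ ^ 2 = ENNReal.ofReal (∫ x, ‖ψ x‖ ^ 2) := by
    rw [ofReal_integral_eq_lintegral_ofReal]
    · refine lintegral_congr fun x => ?_
      rw [ENNReal.ofReal_pow (norm_nonneg _), ofReal_norm]
    · exact (ψ.memLp 2 volume).integrable_norm_pow (by norm_num)
    · exact .of_forall fun x => by positivity
  rw [key, key, SchwartzMap.integral_norm_sq_fourier]

theorem SchwartzMap.enorm_fourierInv_apply_le (φ : 𝓢(E, ℂ)) (x : E) :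
    ‖𝓕⁻ φ x‖ₑ ≤ ∫⁻ ξ, ‖φ ξ‖ₑ := by
  rw [SchwartzMap.fourierInv_coe, Real.fourierInv_eq]
  refine (enorm_integral_le_lintegral_enorm _).trans (lintegral_mono fun ξ => ?_)
  rw [← ofReal_norm, Circle.norm_smul, ofReal_norm]

/-- A sharp frequency cut at radius `R` is replaced by a smooth one, which costs the factor `2`
in the low-frequency radius. -/
theorem SchwartzMap.setLIntegral_enorm_sq_le (u : 𝓢(E, ℂ)) (A : Set E)
    {R : ℝ} (hR : 0 < R) :
    ∫⁻ x in A, ‖u x‖ₑ ^ 2 ≤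
      2 * (∫⁻ ξ in {ξ | R ≤ ‖ξ‖}, ‖𝓕 u ξ‖ₑ ^ 2) +
        2 * (volume A * (∫⁻ ξ in Metric.ball 0 (2 * R), ‖𝓕 u ξ‖ₑ) ^ 2) := by
  let χ : ContDiffBump (0 : E) := ⟨R, 2 * R, hR, by linarith⟩
  have hχs : HasCompactSupport fun ξ => (χ ξ : ℂ) * 𝓕 u ξ :=
    (χ.hasCompactSupport.comp_left (g := ((↑) : ℝ → ℂ)) (by simp)).mul_right
  have hχc : ContDiff ℝ (⊤ : ℕ∞) fun ξ => (χ ξ : ℂ) * 𝓕 u ξ :=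
    (Complex.ofRealCLM.contDiff.comp χ.contDiff).mul ((𝓕 u).smooth ⊤)
  let a : 𝓢(E, ℂ) := hχs.toSchwartzMap hχc
  have ha (ξ : E) : a ξ = (χ ξ : ℂ) * 𝓕 u ξ := rfl
  let b : 𝓢(E, ℂ) := 𝓕 u - a
  have hb (ξ : E) : b ξ = (1 - χ ξ : ℂ) * 𝓕 u ξ := by
    simp only [b, sub_apply, ha]; ring
  have hu (x : E) : u x = 𝓕⁻ b x + 𝓕⁻ a x := by
    rw [← add_apply, ← fourierInv_add, sub_add_cancel, fourierInv_fourier_eq]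
  have low (x : E) : ‖𝓕⁻ a x‖ₑ ≤ ∫⁻ ξ in Metric.ball 0 (2 * R), ‖𝓕 u ξ‖ₑ := by
    refine (a.enorm_fourierInv_apply_le x).trans ?_
    rw [← lintegral_indicator measurableSet_ball]
    refine lintegral_mono fun ξ => ?_
    by_cases hξ : ξ ∈ Metric.ball (0 : E) (2 * R)
    · rw [indicator_of_mem hξ, ha, enorm_mul]
      refine mul_le_of_le_one_left' ?_
      rw [← ofReal_norm, Complex.norm_real, Real.norm_of_nonneg χ.nonneg]
      exact ENNReal.ofReal_le_one.2 χ.le_one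
    · rw [indicator_of_notMem hξ, ha, χ.zero_of_le_dist (by simpa [χ] using hξ)]
      simp
  have high : ∫⁻ x, ‖𝓕⁻ b x‖ₑ ^ 2 ≤ ∫⁻ ξ in {ξ | R ≤ ‖ξ‖}, ‖𝓕 u ξ‖ₑ ^ 2 := by
    rw [← SchwartzMap.lintegral_enorm_sq_fourier, fourier_fourierInv_eq,
      ← lintegral_indicator (measurableSet_le measurable_const measurable_norm)]
    refine lintegral_mono fun ξ => ?_
    by_cases hξ : R ≤ ‖ξ‖
    · rw [indicator_of_mem (by exact hξ), hb, enorm_mul]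
      gcongr
      refine mul_le_of_le_one_left' ?_
      rw [← Complex.ofReal_one, ← Complex.ofReal_sub, ← ofReal_norm, Complex.norm_real,
        Real.norm_of_nonneg (sub_nonneg.2 χ.le_one)]
      exact ENNReal.ofReal_le_one.2 (by linarith [χ.nonneg (x := ξ)])
    · rw [indicator_of_notMem (by exact hξ), hb,
        χ.one_of_mem_closedBall (by simpa [χ] using (not_le.1 hξ).le)]
      simp
  calc
    ∫⁻ x in A, ‖u x‖ₑ ^ 2
      ≤ ∫⁻ x in A, (2 * ‖𝓕⁻ b x‖ₑ ^ 2 +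
          2 * (∫⁻ ξ in Metric.ball 0 (2 * R), ‖𝓕 u ξ‖ₑ) ^ 2) := by
        refine lintegral_mono fun x => ?_
        rw [hu]
        calc ‖𝓕⁻ b x + 𝓕⁻ a x‖ₑ ^ 2 ≤ (‖𝓕⁻ b x‖ₑ + ‖𝓕⁻ a x‖ₑ) ^ 2 := by
              gcongr; exact enorm_add_le _ _
          _ ≤ 2 * (‖𝓕⁻ b x‖ₑ ^ 2 + ‖𝓕⁻ a x‖ₑ ^ 2) := by
              have := ENNReal.rpow_add_le_mul_rpow_add_rpow ‖𝓕⁻ b x‖ₑ ‖𝓕⁻ a x‖ₑ one_le_two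
              norm_num at this
              exact this
          _ ≤ _ := by rw [mul_add]; gcongr; exact low x
    _ = 2 * (∫⁻ x in A, ‖𝓕⁻ b x‖ₑ ^ 2) +
          2 * (volume A * (∫⁻ ξ in Metric.ball 0 (2 * R), ‖𝓕 u ξ‖ₑ) ^ 2) := by
        rw [lintegral_add_right _ measurable_const, lintegral_const_mul' _ _ (by simp),
          setLIntegral_const]
        ring
    _ ≤ _ := by
        gcongr 2 * ?_ + _
        exact (setLIntegral_le_lintegral _ _).trans high

theorem SchwartzMap.fourier_iterate_lineDerivOp_apply (u : 𝓢(E, ℂ)) (e : E) (n : ℕ) (ξ : E) :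
    𝓕 ((∂_{e} : 𝓢(E, ℂ) → 𝓢(E, ℂ))^[n] u) ξ =
      (2 * π * Complex.I * (inner ℝ ξ e : ℝ)) ^ n * 𝓕 u ξ := by
  induction n with
  | zero => simp
  | succ n ih =>
    have : (inner ℝ · e : E → ℝ).HasTemperateGrowth := by fun_prop
    rw [Function.iterate_succ_apply', SchwartzMap.fourier_lineDerivOp_eq, smul_apply,
      smulLeftCLM_apply_apply this, ih]
    simp only [smul_eq_mul, Complex.real_smul]
    ring

/-- The `m`-th order homogeneous Sobolev seminorm is controlled by the pure `m`-th derivatives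
along an orthonormal basis, hence by the full `m`-th derivative. -/
theorem SchwartzMap.lintegral_norm_pow_mul_enorm_fourier_sq_le (u : 𝓢(E, ℂ)) (n : ℕ) :
    ∫⁻ ξ, ENNReal.ofReal (‖ξ‖ ^ (2 * (n + 1))) * ‖𝓕 u ξ‖ₑ ^ 2 ≤
      (Module.finrank ℝ E : ℝ≥0∞) ^ (n + 1) *
        ∫⁻ x, ‖iteratedFDeriv ℝ (n + 1) u x‖ₑ ^ 2 := by
  let b := stdOrthonormalBasis ℝ E
  let v (i) : 𝓢(E, ℂ) := (∂_{b i} : 𝓢(E, ℂ) → 𝓢(E, ℂ))^[n + 1] u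
  have fourier_v (i) (ξ : E) :
      |inner ℝ ξ (b i)| ^ (2 * (n + 1)) * ‖𝓕 u ξ‖ ^ 2 ≤ ‖𝓕 (v i) ξ‖ ^ 2 := by
    rw [SchwartzMap.fourier_iterate_lineDerivOp_apply, norm_mul, norm_pow, mul_pow, mul_comm 2,
      pow_mul]
    gcongr
    simp only [norm_mul, Complex.norm_I, Complex.norm_real, Complex.norm_ofNat, mul_one,
      Real.norm_eq_abs, abs_of_pos pi_pos]
    exact le_mul_of_one_le_left (abs_nonneg _) (by linarith [pi_gt_three])
  have v_le (i) : ∫⁻ x, ‖v i x‖ₑ ^ 2 ≤ ∫⁻ x, ‖iteratedFDeriv ℝ (n + 1) u x‖ₑ ^ 2 := by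
    refine lintegral_mono fun x => ?_
    gcongr
    simp only [v]
    rw [← iteratedLineDerivOp_const_eq_iter_lineDerivOp, iteratedLineDerivOp_eq_iteratedFDeriv,
      enorm_le_iff_norm_le]
    refine (ContinuousMultilinearMap.le_opNorm _ _).trans ?_
    simp
  calc
    _ ≤ ∫⁻ ξ, (Module.finrank ℝ E : ℝ≥0∞) ^ n * ∑ i, ‖𝓕 (v i) ξ‖ₑ ^ 2 := by
        refine lintegral_mono fun ξ => ?_
        simp only [← ofReal_norm, ← ENNReal.ofReal_natCast (Module.finrank ℝ E)]
        simp only [← ENNReal.ofReal_pow, norm_nonneg, Nat.cast_nonneg]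
        rw [← ENNReal.ofReal_sum_of_nonneg (by intros; positivity),
          ← ENNReal.ofReal_mul (by positivity), ← ENNReal.ofReal_mul (by positivity)]
        refine ENNReal.ofReal_le_ofReal ?_
        calc _ ≤ (Module.finrank ℝ E ^ n * ∑ i, |inner ℝ ξ (b i)| ^ (2 * (n + 1))) *
              ‖𝓕 u ξ‖ ^ 2 := by
              gcongr
              simpa using norm_pow_two_mul_le_sum_inner_pow b n ξ
          _ ≤ _ := by
              rw [mul_assoc, Finset.sum_mul]
              gcongr with i
              exact fourier_v i ξ
    _ = (Module.finrank ℝ E : ℝ≥0∞) ^ n * ∑ i, ∫⁻ x, ‖v i x‖ₑ ^ 2 := by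
        rw [lintegral_const_mul _ (by fun_prop), lintegral_finsetSum _ (by fun_prop)]
        simp_rw [SchwartzMap.lintegral_enorm_sq_fourier]
    _ ≤ (Module.finrank ℝ E : ℝ≥0∞) ^ n *
          ∑ _i : Fin (Module.finrank ℝ E), ∫⁻ x, ‖iteratedFDeriv ℝ (n + 1) u x‖ₑ ^ 2 := by
        exact mul_le_mul' le_rfl (Finset.sum_le_sum fun i _ => v_le i)
    _ = _ := by
        rw [Finset.sum_const, Finset.card_univ, Fintype.card_fin, nsmul_eq_mul, pow_succ]
        ring

/-- Homogeneity of the integral of `‖x‖ ^ (-β)` over a centred ball. -/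
theorem lintegral_ball_norm_rpow_neg {β : ℝ} {S : ℝ} (hS : 0 < S) :
    ∫⁻ x in Metric.ball (0 : E) S, ENNReal.ofReal (‖x‖ ^ (-β)) =
      ENNReal.ofReal (S ^ ((Module.finrank ℝ E : ℝ) - β)) *
        ∫⁻ x in Metric.ball (0 : E) 1, ENNReal.ofReal (‖x‖ ^ (-β)) := by
  have hmap := Measure.map_addHaar_smul (volume : Measure E) hS.ne'
  have h1 : (volume : Measure E) = ENNReal.ofReal (S ^ Module.finrank ℝ E) •
      Measure.map (S • ·) (volume : Measure E) := by
    rw [hmap, smul_smul, ← ENNReal.ofReal_mul (by positivity), abs_of_pos (by positivity),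
      mul_inv_cancel₀ (by positivity), ENNReal.ofReal_one, one_smul]
  have hm : Measurable fun x : E => ENNReal.ofReal (‖x‖ ^ (-β)) := by fun_prop
  conv_lhs => rw [h1]
  rw [Measure.restrict_smul, lintegral_smul_measure,
    setLIntegral_map measurableSet_ball hm (by fun_prop)]
  have hpre : (fun x : E => S • x) ⁻¹' Metric.ball 0 S = Metric.ball 0 1 := by
    ext x
    simp only [mem_preimage, mem_ball_zero_iff, norm_smul, Real.norm_of_nonneg hS.le]
    constructor <;> intro h <;> nlinarith
  rw [hpre]
  simp_rw [norm_smul, Real.norm_of_nonneg hS.le, mul_rpow hS.le (norm_nonneg _),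
    ENNReal.ofReal_mul (rpow_nonneg hS.le _)]
  rw [lintegral_const_mul _ hm, smul_eq_mul, ← mul_assoc, ← ENNReal.ofReal_mul (by positivity),
    ← rpow_natCast, ← rpow_add hS, sub_eq_add_neg]

theorem lintegral_unitBall_norm_rpow_neg_lt_top [Nontrivial E] {β : ℝ}
    (hβ : β < Module.finrank ℝ E) :
    ∫⁻ x in Metric.ball (0 : E) 1, ENNReal.ofReal (‖x‖ ^ (-β)) < ⊤ := by
  refine Integrable.lintegral_lt_top ?_
  refine (integrableOn_fun_norm_addHaar volume (f := fun y => y ^ (-β)) (r := 1)).2 ?_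
  have h : IntegrableOn (fun y : ℝ => y ^ ((Module.finrank ℝ E : ℝ) - 1 - β)) (Ioo 0 1) :=
    ((intervalIntegrable_iff_integrableOn_Ioc_of_le zero_le_one).1
      (intervalIntegral.intervalIntegrable_rpow' (by linarith))).mono_set Ioo_subset_Ioc_self
  refine h.congr_fun (fun y hy => ?_) measurableSet_Ioo
  have : 1 ≤ Module.finrank ℝ E := Module.finrank_pos
  simp only [smul_eq_mul]
  rw [← rpow_natCast, ← rpow_add hy.1, Nat.cast_sub this, Nat.cast_one, sub_eq_add_neg _ β]

/-- Cauchy–Schwarz on a centred ball with the weight `‖ξ‖ ^ β`. -/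
theorem sq_setLIntegral_ball_enorm_le [Nontrivial E] {β : ℝ} {g : E → ℂ} (hg : Measurable g)
    {S : ℝ} (hS : 0 < S) :
    (∫⁻ ξ in Metric.ball 0 S, ‖g ξ‖ₑ) ^ 2 ≤
      (ENNReal.ofReal (S ^ ((Module.finrank ℝ E : ℝ) - β)) *
        ∫⁻ x in Metric.ball (0 : E) 1, ENNReal.ofReal (‖x‖ ^ (-β))) *
      ∫⁻ ξ in Metric.ball 0 S, ENNReal.ofReal (‖ξ‖ ^ β) * ‖g ξ‖ₑ ^ 2 := by
  rw [← lintegral_ball_norm_rpow_neg hS]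
  have h : ∫⁻ ξ in Metric.ball (0 : E) S, ‖g ξ‖ₑ =
      ∫⁻ ξ in Metric.ball (0 : E) S,
        ENNReal.ofReal (‖ξ‖ ^ (-β / 2)) * (ENNReal.ofReal (‖ξ‖ ^ (β / 2)) * ‖g ξ‖ₑ) := by
    refine lintegral_congr_ae (ae_restrict_of_ae ?_)
    filter_upwards [Measure.ae_ne volume (0 : E)] with ξ hξ
    have : 0 < ‖ξ‖ := norm_pos_iff.2 hξ
    rw [← mul_assoc, ← ENNReal.ofReal_mul (by positivity), ← rpow_add this]
    simp [neg_div]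
  have hsq (c : ℝ) (ξ : E) :
      ENNReal.ofReal (‖ξ‖ ^ (c / 2)) ^ 2 = ENNReal.ofReal (‖ξ‖ ^ c) := by
    rw [← ENNReal.ofReal_pow (by positivity), ← rpow_mul_natCast (norm_nonneg _)]
    norm_num
  have cs := ENNReal.lintegral_mul_le_Lp_mul_Lq (volume.restrict (Metric.ball (0 : E) S))
    Real.HolderConjugate.two_two (f := fun ξ => ENNReal.ofReal (‖ξ‖ ^ (-β / 2)))
    (g := fun ξ => ENNReal.ofReal (‖ξ‖ ^ (β / 2)) * ‖g ξ‖ₑ) (by fun_prop) (by fun_prop)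
  simp only [Pi.mul_apply, ← h, ENNReal.rpow_two, mul_pow, hsq] at cs
  calc _ ≤ _ := pow_le_pow_left' cs 2
    _ = _ := by
      rw [mul_pow, ← ENNReal.rpow_mul_natCast, ← ENNReal.rpow_mul_natCast]
      norm_num

/-- A Hardy inequality dual to averaging over balls. -/
theorem lintegral_Ioi_mul_setLIntegral_ball_le {p β : ℝ} (hp : 0 < p) (hpβ : p < β)
    {h : E → ℝ≥0∞} (hh : Measurable h) :
    ∫⁻ t in Ioi (0 : ℝ), ENNReal.ofReal (t ^ (p - 1 - β)) *
        ∫⁻ ξ in Metric.ball 0 (2 * t), ENNReal.ofReal (‖ξ‖ ^ β) * h ξ ≤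
      ENNReal.ofReal (2 ^ (β - p) / (β - p)) * ∫⁻ ξ, ENNReal.ofReal (‖ξ‖ ^ p) * h ξ := by
  have hset : MeasurableSet {q : ℝ × E | ‖q.2‖ < 2 * q.1} :=
    measurableSet_lt (by fun_prop) (by fun_prop)
  let F : ℝ × E → ℝ≥0∞ := {q : ℝ × E | ‖q.2‖ < 2 * q.1}.indicator fun q =>
    ENNReal.ofReal (q.1 ^ (p - 1 - β)) * (ENNReal.ofReal (‖q.2‖ ^ β) * h q.2)
  have hF : Measurable F := by
    refine Measurable.indicator ?_ hset
    fun_prop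
  calc
    _ = ∫⁻ t in Ioi (0 : ℝ), ∫⁻ ξ, F (t, ξ) := by
        refine lintegral_congr fun t => ?_
        rw [← lintegral_const_mul _ (by fun_prop), ← lintegral_indicator measurableSet_ball]
        refine lintegral_congr fun ξ => ?_
        simp [F, indicator]
    _ = ∫⁻ ξ, ∫⁻ t in Ioi (0 : ℝ), F (t, ξ) := lintegral_lintegral_swap hF.aemeasurable
    _ ≤ ∫⁻ ξ, ENNReal.ofReal (2 ^ (β - p) / (β - p)) * (ENNReal.ofReal (‖ξ‖ ^ p) * h ξ) := by
        refine lintegral_mono fun ξ => ?_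
        rcases eq_or_ne ξ 0 with rfl | hξ
        · simp [F, indicator, zero_rpow (hp.trans hpβ).ne']
        have hn : 0 < ‖ξ‖ := norm_pos_iff.2 hξ
        calc ∫⁻ t in Ioi (0 : ℝ), F (t, ξ)
            ≤ ∫⁻ t, F (t, ξ) := setLIntegral_le_lintegral _ _
          _ = ∫⁻ t in Ioi (‖ξ‖ / 2), ENNReal.ofReal (t ^ (p - 1 - β)) *
                (ENNReal.ofReal (‖ξ‖ ^ β) * h ξ) := by
              rw [← lintegral_indicator measurableSet_Ioi]
              refine lintegral_congr fun t => ?_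
              simp [F, indicator, div_lt_iff₀', mul_comm]
          _ = ENNReal.ofReal (2 ^ (β - p) / (β - p)) * (ENNReal.ofReal (‖ξ‖ ^ p) * h ξ) := by
              rw [lintegral_mul_const _ (by fun_prop),
                lintegral_Ioi_ofReal_rpow (by linarith) (by positivity), ← mul_assoc, ← mul_assoc]
              congr 1
              have hβp : 0 < β - p := by linarith
              rw [← ENNReal.ofReal_mul' (by positivity), ← ENNReal.ofReal_mul (by positivity)]
              congr 1
              rw [show p - 1 - β + 1 = -(β - p) by ring, rpow_neg (by positivity),
                div_rpow hn.le zero_le_two, neg_div_neg_eq]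
              have : ‖ξ‖ ^ β = ‖ξ‖ ^ (β - p) * ‖ξ‖ ^ p := by rw [← rpow_add hn]; simp
              rw [this]
              have : ‖ξ‖ ^ (β - p) ≠ 0 := by positivity
              field_simp
    _ = _ := lintegral_const_mul _ (by fun_prop)

/-- Fractional Hardy inequality for weak Lebesgue potentials: if `|{U > t}| ≤ t ^ (-d)` for all
`t > 0`, where `d` is the dimension, then `∫ U ^ p |u|²` is controlled by the homogeneous Sobolev
seminorm of order `p / 2` of `u`, for all `0 < p < d`. -/
theorem exists_lintegral_rpow_mul_enorm_sq_le {p : ℝ} (hp : 0 < p)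
    (hpd : p < Module.finrank ℝ E) :
    ∃ C : ℝ≥0∞, C ≠ ⊤ ∧ ∀ U : E → ℝ, Measurable U → 0 ≤ U →
      (∀ t : ℝ, 0 < t → volume {x | t < U x} ≤ ENNReal.ofReal (t ^ (-(Module.finrank ℝ E : ℝ)))) →
      ∀ u : 𝓢(E, ℂ), ∫⁻ x, ENNReal.ofReal (U x ^ p) * ‖u x‖ₑ ^ 2 ≤
        C * ∫⁻ ξ, ENNReal.ofReal (‖ξ‖ ^ p) * ‖𝓕 u ξ‖ₑ ^ 2 := by
  have : Nontrivial E := Module.nontrivial_of_finrank_pos (R := ℝ) (by exact_mod_cast hp.trans hpd)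
  set d : ℝ := ((Module.finrank ℝ E : ℕ) : ℝ)
  obtain ⟨β, hpβ, hβd⟩ := exists_between hpd
  set K : ℝ≥0∞ := ∫⁻ x in Metric.ball (0 : E) 1, ENNReal.ofReal (‖x‖ ^ (-β))
  have hKtop : K ≠ ⊤ := (lintegral_unitBall_norm_rpow_neg_lt_top hβd).ne
  set L : ℝ≥0∞ := 2 * ENNReal.ofReal (2 ^ (d - β)) * K with hL
  have hLtop : L ≠ ⊤ := by finiteness
  refine ⟨2 + ENNReal.ofReal p * L * ENNReal.ofReal (2 ^ (β - p) / (β - p)), by finiteness,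
    fun U hU hU0 hUd u => ?_⟩
  have hu2 : Measurable fun x => ‖u x‖ₑ ^ 2 := by fun_prop
  have hg2 : Measurable fun ξ => ‖𝓕 u ξ‖ₑ ^ 2 := by fun_prop
  have layer (h : E → ℝ≥0∞) (hh : Measurable h) (W : E → ℝ) (hW : Measurable W) :
      ∫⁻ x, ENNReal.ofReal (W x ^ p) * h x =
        ∫⁻ x, ENNReal.ofReal (W x ^ p) ∂(volume.withDensity h) := by
    rw [lintegral_withDensity_eq_lintegral_mul _ hh (by fun_prop)]
    simp only [Pi.mul_apply, mul_comm]
  set B : ℝ → ℝ≥0∞ := fun t => ∫⁻ ξ in Metric.ball 0 (2 * t),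
    ENNReal.ofReal (‖ξ‖ ^ β) * ‖𝓕 u ξ‖ₑ ^ 2
  have level (t : ℝ) (ht : 0 < t) : ∫⁻ x in {x | t < U x}, ‖u x‖ₑ ^ 2 ≤
      2 * (∫⁻ ξ in {ξ | t ≤ ‖ξ‖}, ‖𝓕 u ξ‖ₑ ^ 2) +
        L * (ENNReal.ofReal (t ^ (-β)) * B t) := by
    refine (u.setLIntegral_enorm_sq_le _ ht).trans ?_
    gcongr _ + ?_
    calc _ ≤ 2 * (ENNReal.ofReal (t ^ (-d)) *
          (ENNReal.ofReal ((2 * t) ^ (d - β)) * K * B t)) := by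
          gcongr
          · exact hUd t ht
          · exact sq_setLIntegral_ball_enorm_le (by fun_prop) (by positivity)
      _ = _ := by
          rw [mul_rpow zero_le_two ht.le, ENNReal.ofReal_mul (by positivity), hL,
            show -β = -d + (d - β) by ring, rpow_add ht, ENNReal.ofReal_mul (by positivity)]
          ring
  have tail : ENNReal.ofReal p * ∫⁻ t in Ioi (0 : ℝ),
      (∫⁻ ξ in {ξ | t ≤ ‖ξ‖}, ‖𝓕 u ξ‖ₑ ^ 2) * ENNReal.ofReal (t ^ (p - 1)) =
        ∫⁻ ξ, ENNReal.ofReal (‖ξ‖ ^ p) * ‖𝓕 u ξ‖ₑ ^ 2 := by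
    rw [layer _ hg2 _ measurable_norm, lintegral_rpow_eq_lintegral_meas_le_mul _
      (.of_forall fun ξ => norm_nonneg ξ) (by fun_prop) hp]
    simp_rw [withDensity_apply _ (measurableSet_le measurable_const measurable_norm)]
  calc
    ∫⁻ x, ENNReal.ofReal (U x ^ p) * ‖u x‖ₑ ^ 2
      = ENNReal.ofReal p * ∫⁻ t in Ioi (0 : ℝ),
          (∫⁻ x in {x | t < U x}, ‖u x‖ₑ ^ 2) * ENNReal.ofReal (t ^ (p - 1)) := by
        rw [layer _ hu2 _ hU, lintegral_rpow_eq_lintegral_meas_lt_mul _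
          (.of_forall hU0) hU.aemeasurable hp]
        simp_rw [withDensity_apply _ (measurableSet_lt measurable_const hU)]
    _ ≤ ENNReal.ofReal p * ∫⁻ t in Ioi (0 : ℝ),
          (2 * ((∫⁻ ξ in {ξ | t ≤ ‖ξ‖}, ‖𝓕 u ξ‖ₑ ^ 2) * ENNReal.ofReal (t ^ (p - 1))) +
            L * (ENNReal.ofReal (t ^ (p - 1 - β)) * B t)) := by
        gcongr ENNReal.ofReal p * ?_
        refine setLIntegral_mono' measurableSet_Ioi fun t (ht : 0 < t) => ?_
        refine (mul_le_mul' (level t ht) le_rfl).trans_eq ?_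
        rw [show p - 1 - β = -β + (p - 1) by ring, rpow_add ht, ENNReal.ofReal_mul (by positivity)]
        ring
    _ = 2 * (ENNReal.ofReal p * ∫⁻ t in Ioi (0 : ℝ),
          (∫⁻ ξ in {ξ | t ≤ ‖ξ‖}, ‖𝓕 u ξ‖ₑ ^ 2) * ENNReal.ofReal (t ^ (p - 1))) +
        ENNReal.ofReal p * L * ∫⁻ t in Ioi (0 : ℝ),
          ENNReal.ofReal (t ^ (p - 1 - β)) * B t := by
        have hanti : Antitone fun t : ℝ => ∫⁻ ξ in {ξ | t ≤ ‖ξ‖}, ‖𝓕 u ξ‖ₑ ^ 2 :=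
          fun s t hst => lintegral_mono_set fun ξ hξ => hst.trans hξ
        have hmeas := hanti.measurable
        rw [lintegral_add_left (by fun_prop), lintegral_const_mul' _ _ (by simp),
          lintegral_const_mul' _ _ hLtop]
        ring
    _ ≤ _ := by
        rw [tail, add_mul, mul_assoc _ (ENNReal.ofReal (2 ^ (β - p) / (β - p)))]
        gcongr
        exact lintegral_Ioi_mul_setLIntegral_ball_le hp hpβ hg2

end Fourier

theorem ae_eq_zero_of_weakLpNorm_eq_zero {α : Type*} [MeasurableSpace α] {μ : Measure α} {r : ℝ}
    (hr : 0 < r) {g : α → ℝ} (hg : weakLpNorm μ r g = 0) : g =ᵐ[μ] 0 := by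
  have h (n : ℕ) : μ {x | 1 / (n + 1 : ℝ) < |g x|} = 0 := by
    have hn : (0 : ℝ) < 1 / (n + 1) := by positivity
    simp only [weakLpNorm, ENNReal.iSup_eq_zero, mul_eq_zero, ENNReal.ofReal_eq_zero] at hg
    have := (hg _ hn).resolve_left hn.not_ge
    rw [ENNReal.rpow_eq_zero_iff_of_pos (by positivity)] at this
    exact this
  rw [Filter.EventuallyEq, ae_iff]
  refine measure_mono_null (fun x hx => ?_) (measure_iUnion_null h)
  obtain ⟨n, hn⟩ := exists_nat_one_div_lt (abs_pos.2 hx)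
  exact mem_iUnion.2 ⟨n, hn⟩

theorem measure_lt_abs_le_of_weakLpNorm_le {α : Type*} [MeasurableSpace α] {μ : Measure α} {r : ℝ}
    (hr : 0 < r) {g : α → ℝ} {w : ℝ} (hg : weakLpNorm μ r g ≤ ENNReal.ofReal w)
    {γ : ℝ} (hγ : 0 < γ) : μ {x | γ < |g x|} ≤ ENNReal.ofReal (w / γ) ^ r := by
  have h : ENNReal.ofReal γ * μ {x | γ < |g x|} ^ (1 / r) ≤ ENNReal.ofReal w :=
    (le_iSup₂ (f := fun (γ : ℝ) (_ : 0 < γ) =>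
      ENNReal.ofReal γ * μ {x | γ < |g x|} ^ (1 / r)) γ hγ).trans hg
  rw [mul_comm, ← ENNReal.le_div_iff_mul_le (by simp [hγ]) (by simp),
    ← ENNReal.ofReal_div_of_pos hγ, one_div, ENNReal.rpow_inv_le_iff hr] at h
  exact h

/-- Hardy-type inequality for weak `L^{N/2m}` potentials, `N > 2m`:
`∫ |V| |f|² ≤ C ‖V‖_{L^{N/2m,∞}} ‖∇^m f‖_{L²}²` for all test functions `f`. -/
theorem stmt_10 (m N : ℕ) (hm : 1 ≤ m) (hN : 2 * m < N) :
    ∃ C : ℝ, 0 < C ∧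
      ∀ V : EuclideanSpace ℝ (Fin N) → ℝ, Measurable V →
        weakLpNorm volume ((N : ℝ) / (2 * m)) V < ⊤ →
        ∀ f : EuclideanSpace ℝ (Fin N) → ℂ,
          ContDiff ℝ (⊤ : ℕ∞) f → HasCompactSupport f →
          (∫⁻ x, ENNReal.ofReal |V x| * (‖f x‖₊ : ℝ≥0∞) ^ 2) ≤
            ENNReal.ofReal C * weakLpNorm volume ((N : ℝ) / (2 * m)) V *
              ∫⁻ x, (‖iteratedFDeriv ℝ m f x‖₊ : ℝ≥0∞) ^ 2 := by
  obtain ⟨n, rfl⟩ := Nat.exists_eq_add_of_le' hm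
  set p : ℝ := 2 * ((n + 1 : ℕ) : ℝ) with hp
  have hp0 : 0 < p := by positivity
  have hN0 : 0 < (N : ℝ) := by exact_mod_cast (Nat.zero_le _).trans_lt hN
  have hr : 0 < (N : ℝ) / p := by positivity
  have hdim : Module.finrank ℝ (EuclideanSpace ℝ (Fin N)) = N := by simp
  obtain ⟨C, hC, hardy⟩ := exists_lintegral_rpow_mul_enorm_sq_le
    (E := EuclideanSpace ℝ (Fin N)) hp0 (by rw [hdim, hp]; exact_mod_cast hN)
  rw [hdim] at hardy
  set D : ℝ≥0∞ := C * (N : ℝ≥0∞) ^ (n + 1) with hD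
  have hDtop : D ≠ ⊤ := by finiteness
  refine ⟨D.toReal + 1, by positivity, fun V hV hVtop f hf hfs => ?_⟩
  rcases eq_or_ne (weakLpNorm volume ((N : ℝ) / p) V) 0 with hV0 | hV0
  · rw [lintegral_congr_ae (g := 0), Pi.zero_def, lintegral_zero]
    · exact zero_le
    · filter_upwards [ae_eq_zero_of_weakLpNorm_eq_zero hr hV0] with x hx
      simp [hx]
  set w : ℝ := (weakLpNorm volume ((N : ℝ) / p) V).toReal
  have hw0 : 0 < w := ENNReal.toReal_pos hV0 hVtop.ne
  have hwV : weakLpNorm volume ((N : ℝ) / p) V = ENNReal.ofReal w :=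
    (ENNReal.ofReal_toReal hVtop.ne).symm
  let U (x : EuclideanSpace ℝ (Fin N)) : ℝ := (|V x| / w) ^ p⁻¹
  have hU (t : ℝ) (ht : 0 < t) : volume {x | t < U x} ≤ ENNReal.ofReal (t ^ (-(N : ℝ))) := by
    have hset : {x | t < U x} = {x | w * t ^ p < |V x|} := by
      ext x
      simp only [mem_ofPred_eq, U]
      rw [lt_rpow_inv_iff_of_pos ht.le (by positivity) hp0, lt_div_iff₀' hw0]
    rw [hset]
    refine (measure_lt_abs_le_of_weakLpNorm_le hr hwV.le (by positivity)).trans_eq ?_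
    rw [ENNReal.ofReal_rpow_of_pos (by positivity), div_mul_cancel_left₀ hw0.ne',
      ← rpow_neg ht.le, ← rpow_mul ht.le]
    congr 2
    field_simp
  let u : 𝓢(EuclideanSpace ℝ (Fin N), ℂ) := hfs.toSchwartzMap hf
  have hUV (x) : ENNReal.ofReal |V x| = ENNReal.ofReal w * ENNReal.ofReal (U x ^ p) := by
    rw [← ENNReal.ofReal_mul hw0.le, rpow_inv_rpow (by positivity) hp0.ne',
      mul_div_cancel₀ _ hw0.ne']
  have sobolev := u.lintegral_norm_pow_mul_enorm_fourier_sq_le n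
  rw [hdim] at sobolev
  calc
    ∫⁻ x, ENNReal.ofReal |V x| * (‖f x‖₊ : ℝ≥0∞) ^ 2
      = ENNReal.ofReal w * ∫⁻ x, ENNReal.ofReal (U x ^ p) * ‖u x‖ₑ ^ 2 := by
        rw [← lintegral_const_mul' _ _ ENNReal.ofReal_ne_top]
        refine lintegral_congr fun x => ?_
        rw [hUV, mul_assoc]
        rfl
    _ ≤ ENNReal.ofReal w * (C * ∫⁻ ξ, ENNReal.ofReal (‖ξ‖ ^ p) * ‖𝓕 u ξ‖ₑ ^ 2) := by
        gcongr
        exact hardy U (by fun_prop) (fun x => by positivity) hU u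
    _ ≤ ENNReal.ofReal w * (C * ((N : ℝ≥0∞) ^ (n + 1) *
          ∫⁻ x, ‖iteratedFDeriv ℝ (n + 1) u x‖ₑ ^ 2)) := by
        gcongr
        refine le_trans (le_of_eq (lintegral_congr fun ξ => ?_)) sobolev
        rw [hp, ← rpow_natCast]
        push_cast
        rfl
    _ = D * ENNReal.ofReal w * ∫⁻ x, ‖iteratedFDeriv ℝ (n + 1) u x‖ₑ ^ 2 := by
        rw [hD]; ring
    _ ≤ ENNReal.ofReal (D.toReal + 1) * ENNReal.ofReal w *
          ∫⁻ x, ‖iteratedFDeriv ℝ (n + 1) u x‖ₑ ^ 2 := by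
        gcongr
        exact (ENNReal.ofReal_toReal hDtop).symm.le.trans
          (ENNReal.ofReal_le_ofReal (by linarith))
    _ = _ := by rw [hwV]; rfl
end

section
/- Let m ≥ 1 and N > 2m. There exists a constant κ(m, N) > 0 such that for every f ∈ C_c^∞(ℝᴺ; ℂ), ∫_{ℝᴺ} |x|^{−2m} |f(x)|² dx ≤ κ(m, N) ‖∇^m f‖_{L²(ℝᴺ)}². -/
open MeasureTheory
open scoped ENNReal NNReal

/-- The Cauchy–Schwarz inequality for the lower Lebesgue integral. -/
lemma sq_lintegral_mul_le {α : Type*} [MeasurableSpace α] (μ : Measure α) {u v : α → ℝ≥0∞}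
    (hu : AEMeasurable u μ) (hv : AEMeasurable v μ) :
    (∫⁻ a, u a * v a ∂μ) ^ 2 ≤ (∫⁻ a, u a ^ 2 ∂μ) * ∫⁻ a, v a ^ 2 ∂μ := by
  have h := ENNReal.lintegral_mul_le_Lp_mul_Lq μ Real.HolderConjugate.two_two hu hv
  simp only [Pi.mul_apply, ENNReal.rpow_two] at h
  refine (pow_le_pow_left' h 2).trans_eq ?_
  rw [mul_pow, ← ENNReal.rpow_mul_natCast, ← ENNReal.rpow_mul_natCast]
  norm_num

lemma ofReal_rpow_mul_ofReal_rpow {t : ℝ} (ht : 0 < t) (a b : ℝ) :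
    ENNReal.ofReal (t ^ a) * ENNReal.ofReal (t ^ b) = ENNReal.ofReal (t ^ (a + b)) := by
  rw [← ENNReal.ofReal_mul (by positivity), Real.rpow_add ht]

/-- A weighted Cauchy–Schwarz inequality on the half-line `[1, ∞)`. -/
lemma sq_lintegral_Ici_le {v : ℝ → ℝ≥0∞} (hv : Measurable v) :
    (∫⁻ t in Set.Ici (1 : ℝ), v t) ^ 2 ≤
      (∫⁻ t in Set.Ici (1 : ℝ), ENNReal.ofReal (t ^ (-3 / 2 : ℝ))) *
        ∫⁻ t in Set.Ici (1 : ℝ), ENNReal.ofReal (t ^ (3 / 2 : ℝ)) * v t ^ 2 := by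
  have h := sq_lintegral_mul_le (volume.restrict (Set.Ici (1 : ℝ)))
    (u := fun t ↦ ENNReal.ofReal (t ^ (-3 / 4 : ℝ)))
    (v := fun t ↦ ENNReal.ofReal (t ^ (3 / 4 : ℝ)) * v t) (by fun_prop) (by fun_prop)
  convert h using 2
  · refine setLIntegral_congr_fun measurableSet_Ici fun t ht ↦ ?_
    have ht : 0 < t := zero_lt_one.trans_le ht
    simp only [← mul_assoc]
    rw [ofReal_rpow_mul_ofReal_rpow ht]
    norm_num
  · refine setLIntegral_congr_fun measurableSet_Ici fun t ht ↦ ?_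
    have ht : 0 < t := zero_lt_one.trans_le ht
    simp only [sq]
    rw [ofReal_rpow_mul_ofReal_rpow ht]
    norm_num
  · refine setLIntegral_congr_fun measurableSet_Ici fun t ht ↦ ?_
    have ht : 0 < t := zero_lt_one.trans_le ht
    simp only [mul_pow]
    rw [sq (ENNReal.ofReal _), ofReal_rpow_mul_ofReal_rpow ht]
    norm_num

lemma lintegral_Ici_rpow_lt_top :
    ∫⁻ t in Set.Ici (1 : ℝ), ENNReal.ofReal (t ^ (-3 / 2 : ℝ)) < ∞ := by
  have h : IntegrableOn (fun t : ℝ ↦ t ^ (-3 / 2 : ℝ)) (Set.Ici 1) :=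
    (integrableOn_Ici_iff_integrableOn_Ioi).2
      (integrableOn_Ioi_rpow_of_lt (by norm_num) zero_lt_one)
  exact h.lintegral_lt_top

section

variable {E F : Type*} [NormedAddCommGroup E] [NormedSpace ℝ E]
  [NormedAddCommGroup F] [NormedSpace ℝ F]

/-- A compactly supported function is bounded by the integral of its derivative along the
outgoing ray. -/
lemma enorm_le_lintegral_Ici_fderiv {g : E → F} (hg : ContDiff ℝ 1 g)
    (hgc : HasCompactSupport g) {x : E} (hx : x ≠ 0) :
    ‖g x‖ₑ ≤ (∫⁻ t in Set.Ici (1 : ℝ), ‖fderiv ℝ g (t • x)‖ₑ) * ‖x‖ₑ := by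
  have hsmooth : ContDiff ℝ 1 fun t : ℝ ↦ g (t • -x) := by fun_prop
  have hcomp : HasCompactSupport fun t : ℝ ↦ g (t • -x) :=
    hgc.comp_isClosedEmbedding (isClosedEmbedding_smul_left (neg_ne_zero.2 hx))
  have h := hcomp.enorm_le_lintegral_Ici_deriv hsmooth (-1)
  have hderiv (t : ℝ) : ‖deriv (fun t : ℝ ↦ g (t • -x)) t‖ₑ ≤
      ‖fderiv ℝ g ((-t) • x)‖ₑ * ‖x‖ₑ := by
    have h1 : HasDerivAt (fun t : ℝ ↦ t • -x) (-x) t := by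
      simpa using (hasDerivAt_id t).smul_const (-x)
    have h2 := ((hg.differentiable one_ne_zero (t • -x)).hasFDerivAt.comp_hasDerivAt t h1).deriv
    rw [Function.comp_def] at h2
    rw [h2, smul_neg, ← neg_smul, ← enorm_neg x]
    exact ContinuousLinearMap.le_opENorm _ _
  have hpre : (Neg.neg : ℝ → ℝ) ⁻¹' Set.Ici 1 = Set.Iic (-1) := by
    ext t; simp [le_neg]
  calc ‖g x‖ₑ = ‖g ((-1 : ℝ) • -x)‖ₑ := by simp
    _ ≤ ∫⁻ t in Set.Iic (-1 : ℝ), ‖fderiv ℝ g ((-t) • x)‖ₑ * ‖x‖ₑ :=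
      h.trans (lintegral_mono hderiv)
    _ = ∫⁻ t in Set.Ici (1 : ℝ), ‖fderiv ℝ g (t • x)‖ₑ * ‖x‖ₑ := by
      rw [← hpre]
      exact (Measure.measurePreserving_neg (volume : Measure ℝ)).setLIntegral_comp_preimage_emb
        (MeasurableEquiv.neg ℝ).measurableEmbedding
        (fun t ↦ ‖fderiv ℝ g (t • x)‖ₑ * ‖x‖ₑ) _
    _ = _ := lintegral_mul_const' _ _ enorm_ne_top

lemma ofReal_norm_rpow_mul_enorm_sq_le {g : E → F} (hg : ContDiff ℝ 1 g)
    (hgc : HasCompactSupport g) (k : ℕ) (x : E) :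
    ENNReal.ofReal (‖x‖ ^ (-(2 * ((k + 1 : ℕ) : ℝ)))) * ‖g x‖ₑ ^ 2 ≤
      ENNReal.ofReal (‖x‖ ^ (-(2 * (k : ℝ)))) *
        (∫⁻ t in Set.Ici (1 : ℝ), ‖fderiv ℝ g (t • x)‖ₑ) ^ 2 := by
  rcases eq_or_ne x 0 with rfl | hx
  · rw [norm_zero, Real.zero_rpow (by rw [neg_ne_zero]; positivity)]
    simp
  have hpos : 0 < ‖x‖ := norm_pos_iff.2 hx
  have hweight : ENNReal.ofReal (‖x‖ ^ (-(2 * ((k + 1 : ℕ) : ℝ)))) * ‖x‖ₑ ^ 2 =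
      ENNReal.ofReal (‖x‖ ^ (-(2 * (k : ℝ)))) := by
    rw [← ofReal_norm, ← ENNReal.ofReal_pow hpos.le, ← Real.rpow_two,
      ofReal_rpow_mul_ofReal_rpow hpos]
    congr 2
    push_cast
    ring
  calc _ ≤ ENNReal.ofReal (‖x‖ ^ (-(2 * ((k + 1 : ℕ) : ℝ)))) *
        ((∫⁻ t in Set.Ici (1 : ℝ), ‖fderiv ℝ g (t • x)‖ₑ) * ‖x‖ₑ) ^ 2 := by
        gcongr
        exact enorm_le_lintegral_Ici_fderiv hg hgc hx
    _ = _ := by rw [← hweight]; ring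

variable [MeasurableSpace E] [BorelSpace E] [FiniteDimensional ℝ E]
  (μ : Measure E) [μ.IsAddHaarMeasure]

lemma lintegral_comp_smul_addHaar (G : E → ℝ≥0∞) {t : ℝ} (ht : 0 < t) :
    ∫⁻ x, G (t • x) ∂μ =
      ENNReal.ofReal (t ^ (-(Module.finrank ℝ E : ℝ))) * ∫⁻ x, G x ∂μ := by
  have h := (measurableEmbedding_const_smul₀ (α := E) ht.ne').lintegral_map (μ := μ) G
  rw [← h, Measure.map_addHaar_smul μ ht.ne', lintegral_smul_measure, smul_eq_mul,
    Real.rpow_neg ht.le, Real.rpow_natCast, abs_of_pos (by positivity)]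

lemma lintegral_ofReal_norm_rpow_mul_comp_smul (G : E → ℝ≥0∞) (a : ℝ) {t : ℝ} (ht : 0 < t) :
    ∫⁻ x, ENNReal.ofReal (‖x‖ ^ (-a)) * G (t • x) ∂μ =
      ENNReal.ofReal (t ^ (a - Module.finrank ℝ E)) *
        ∫⁻ x, ENNReal.ofReal (‖x‖ ^ (-a)) * G x ∂μ := by
  have h := lintegral_comp_smul_addHaar μ (fun x ↦ ENNReal.ofReal (‖x‖ ^ (-a)) * G x) ht
  rw [sub_eq_add_neg, ← ofReal_rpow_mul_ofReal_rpow ht, mul_assoc, ← h,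
    ← lintegral_const_mul' _ _ ENNReal.ofReal_ne_top]
  congr with x
  rw [norm_smul, Real.norm_of_nonneg ht.le, Real.mul_rpow ht.le (norm_nonneg x),
    ENNReal.ofReal_mul (by positivity), ← mul_assoc, ← mul_assoc,
    ofReal_rpow_mul_ofReal_rpow ht]
  simp

/-- The weighted Hardy inequality, with a constant independent of the space and the weight. -/
lemma lintegral_ofReal_norm_rpow_mul_enorm_sq_le {g : E → F} (hg : ContDiff ℝ 1 g)
    (hgc : HasCompactSupport g) {k : ℕ} (hk : 2 * (k + 1) < Module.finrank ℝ E) :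
    ∫⁻ x, ENNReal.ofReal (‖x‖ ^ (-(2 * ((k + 1 : ℕ) : ℝ)))) * ‖g x‖ₑ ^ 2 ∂μ ≤
      (∫⁻ t in Set.Ici (1 : ℝ), ENNReal.ofReal (t ^ (-3 / 2 : ℝ))) ^ 2 *
        ∫⁻ x, ENNReal.ofReal (‖x‖ ^ (-(2 * (k : ℝ)))) * ‖fderiv ℝ g x‖ₑ ^ 2 ∂μ := by
  set A := ∫⁻ t in Set.Ici (1 : ℝ), ENNReal.ofReal (t ^ (-3 / 2 : ℝ))
  set W := ∫⁻ x, ENNReal.ofReal (‖x‖ ^ (-(2 * (k : ℝ)))) * ‖fderiv ℝ g x‖ₑ ^ 2 ∂μ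
  have hA : A ≠ ∞ := lintegral_Ici_rpow_lt_top.ne
  have hcont : Continuous (fderiv ℝ g) := hg.continuous_fderiv one_ne_zero
  have hfin : 2 * ((k : ℝ) + 1) + 1 ≤ Module.finrank ℝ E := by exact_mod_cast hk
  calc
    _ ≤ ∫⁻ x, A * (∫⁻ t in Set.Ici (1 : ℝ), ENNReal.ofReal (t ^ (3 / 2 : ℝ)) *
          (ENNReal.ofReal (‖x‖ ^ (-(2 * (k : ℝ)))) * ‖fderiv ℝ g (t • x)‖ₑ ^ 2)) ∂μ := by
      refine lintegral_mono fun x ↦ (ofReal_norm_rpow_mul_enorm_sq_le hg hgc k x).trans ?_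
      have hmeas : Measurable fun t : ℝ ↦ ‖fderiv ℝ g (t • x)‖ₑ :=
        (hcont.comp (by fun_prop : Continuous fun t : ℝ ↦ t • x)).enorm.measurable
      refine (mul_le_mul_right (sq_lintegral_Ici_le hmeas) _).trans_eq ?_
      rw [mul_left_comm, ← lintegral_const_mul' _ _ ENNReal.ofReal_ne_top]
      simp only [mul_left_comm]
      rfl
    _ = A * ∫⁻ t in Set.Ici (1 : ℝ), ENNReal.ofReal (t ^ (3 / 2 : ℝ)) *
          ∫⁻ x, ENNReal.ofReal (‖x‖ ^ (-(2 * (k : ℝ)))) * ‖fderiv ℝ g (t • x)‖ₑ ^ 2 ∂μ := by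
      rw [lintegral_const_mul' _ _ hA, lintegral_lintegral_swap]
      · simp only [lintegral_const_mul' _ _ ENNReal.ofReal_ne_top]
      · have hmeas : Measurable fun p : E × ℝ ↦ ‖fderiv ℝ g (p.2 • p.1)‖ₑ :=
          (hcont.comp (by fun_prop : Continuous fun p : E × ℝ ↦ p.2 • p.1)).enorm.measurable
        simp only [Function.uncurry_def]
        fun_prop
    _ ≤ A * ∫⁻ t in Set.Ici (1 : ℝ), ENNReal.ofReal (t ^ (-3 / 2 : ℝ)) * W := by
      gcongr A * ?_
      refine setLIntegral_mono' measurableSet_Ici fun t (ht : 1 ≤ t) ↦ ?_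
      have ht0 : 0 < t := zero_lt_one.trans_le ht
      rw [lintegral_ofReal_norm_rpow_mul_comp_smul μ (fun y ↦ ‖fderiv ℝ g y‖ₑ ^ 2) _ ht0,
        ← mul_assoc, ofReal_rpow_mul_ofReal_rpow ht0]
      gcongr
      linarith
    _ = A ^ 2 * W := by
      rw [lintegral_mul_const _ (by fun_prop), ← mul_assoc, sq]

/-- The iterated weighted Hardy inequality. -/
lemma lintegral_ofReal_norm_rpow_mul_enorm_iteratedFDeriv_sq_le {f : E → F}
    (hf : ContDiff ℝ (⊤ : ℕ∞) f) (hfc : HasCompactSupport f) (k : ℕ) :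
    ∀ j n : ℕ, j + k = n → 2 * k < Module.finrank ℝ E →
      ∫⁻ x, ENNReal.ofReal (‖x‖ ^ (-(2 * (k : ℝ)))) * ‖iteratedFDeriv ℝ j f x‖ₑ ^ 2 ∂μ ≤
        ((∫⁻ t in Set.Ici (1 : ℝ), ENNReal.ofReal (t ^ (-3 / 2 : ℝ))) ^ 2) ^ k *
          ∫⁻ x, ‖iteratedFDeriv ℝ n f x‖ₑ ^ 2 ∂μ := by
  induction k with
  | zero => rintro j _ rfl _; simp
  | succ k ih =>
    intro j n hn hk
    have hsmooth : ContDiff ℝ 1 (iteratedFDeriv ℝ j f) :=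
      hf.iteratedFDeriv_right (by exact_mod_cast le_top)
    refine (lintegral_ofReal_norm_rpow_mul_enorm_sq_le μ hsmooth (hfc.iteratedFDeriv j)
      hk).trans ?_
    have hnorm (x : E) :
        ‖fderiv ℝ (iteratedFDeriv ℝ j f) x‖ₑ = ‖iteratedFDeriv ℝ (j + 1) f x‖ₑ := by
      rw [← ofReal_norm, ← ofReal_norm, norm_fderiv_iteratedFDeriv]
    simp only [hnorm]
    rw [pow_succ' _ k, mul_assoc]
    gcongr
    exact ih (j + 1) n (by omega) (by omega)

end

/-- the Rellich/Hardy inequality of Davies–Hinz: for `N > 2m`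
there is `κ(m,N) > 0` with `∫ |x|^{-2m} |f(x)|² dx ≤ κ(m,N) ‖∇^m f‖_{L²}²`
for every test function `f`. -/
theorem stmt_12 (m N : ℕ) (hm : 1 ≤ m) (hN : 2 * m < N) :
    ∃ κ : ℝ, 0 < κ ∧
      ∀ f : EuclideanSpace ℝ (Fin N) → ℂ,
        ContDiff ℝ (⊤ : ℕ∞) f → HasCompactSupport f →
        (∫⁻ x, ENNReal.ofReal (‖x‖ ^ (-(2 * (m : ℝ)))) * (‖f x‖₊ : ℝ≥0∞) ^ 2) ≤
          ENNReal.ofReal κ * ∫⁻ x, (‖iteratedFDeriv ℝ m f x‖₊ : ℝ≥0∞) ^ 2 := by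
  set C := ((∫⁻ t in Set.Ici (1 : ℝ), ENNReal.ofReal (t ^ (-3 / 2 : ℝ))) ^ 2) ^ m
  have hC : C ≠ ∞ := ENNReal.pow_ne_top (ENNReal.pow_ne_top lintegral_Ici_rpow_lt_top.ne)
  refine ⟨C.toReal + 1, by positivity, fun f hf hfc ↦ ?_⟩
  have h := lintegral_ofReal_norm_rpow_mul_enorm_iteratedFDeriv_sq_le volume hf hfc m 0 m
    (zero_add m) (by simpa using hN)
  have hnorm (x : EuclideanSpace ℝ (Fin N)) : ‖iteratedFDeriv ℝ 0 f x‖ₑ = ‖f x‖ₑ := by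
    rw [← ofReal_norm, ← ofReal_norm, norm_iteratedFDeriv_zero]
  simp only [hnorm] at h
  simp only [← enorm_eq_nnnorm]
  refine h.trans ?_
  gcongr
  exact (ENNReal.ofReal_toReal hC).ge.trans (ENNReal.ofReal_le_ofReal (by linarith))
end

section
/- Let m ≥ 1, N > 2m, and 1 < p < N/(2m). There exists a constant K(m, N, p) > 0 such that for every f ∈ C_c^∞(ℝᴺ \ {0}; ℂ), ‖ |x|^{−2m} f ‖_{L^p(ℝᴺ)} ≤ K(m, N, p) ‖ (−Δ)^m f ‖_{L^p(ℝᴺ)}. -/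
open MeasureTheory
open scoped ENNReal NNReal

/-- The partial derivative `∂_i f` of a function on `ℝᴺ`. -/
noncomputable def pderivE {N : ℕ} (i : Fin N)
    (f : EuclideanSpace ℝ (Fin N) → ℂ) : EuclideanSpace ℝ (Fin N) → ℂ :=
  fun x => fderiv ℝ f x (EuclideanSpace.single i 1)

/-- The polyharmonic operator `(-Δ)^m`, the `m`-fold iterate of
`g ↦ -∑ i, ∂²g/∂x_i²`. -/
noncomputable def negLapPow {N : ℕ} (m : ℕ)
    (f : EuclideanSpace ℝ (Fin N) → ℂ) : EuclideanSpace ℝ (Fin N) → ℂ :=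
  (fun g x => -∑ i : Fin N, pderivE i (pderivE i g) x)^[m] f

open Filter Topology

section DirectionalDerivatives

variable {E F : Type*} [NormedAddCommGroup E] [NormedSpace ℝ E]
  [NormedAddCommGroup F] [NormedSpace ℝ F]

/-- The derivative of `g` in the direction `v`. -/
noncomputable def dirDeriv (v : E) (g : E → F) : E → F := fun x => fderiv ℝ g x v

theorem contDiff_dirDeriv {g : E → F} (hg : ContDiff ℝ (⊤ : ℕ∞) g) (v : E) :
    ContDiff ℝ (⊤ : ℕ∞) (dirDeriv v g) :=
  (hg.fderiv_right (m := (⊤ : ℕ∞)) le_rfl).clm_apply contDiff_const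

theorem hasCompactSupport_dirDeriv {g : E → F} (hg : HasCompactSupport g) (v : E) :
    HasCompactSupport (dirDeriv v g) :=
  hg.fderiv_apply ℝ v

theorem differentiableAt_of_smooth {g : E → F} (hg : ContDiff ℝ (⊤ : ℕ∞) g) (x : E) :
    DifferentiableAt ℝ g x :=
  (hg.differentiable (by simp)) x

theorem dirDeriv_rpow {g : E → ℝ} (hg : ContDiff ℝ (⊤ : ℕ∞) g) (hpos : ∀ x, 0 < g x)
    (r : ℝ) (v : E) :
    dirDeriv v (fun x => g x ^ r) = fun x => r * g x ^ (r - 1) * dirDeriv v g x := by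
  funext x
  have h := (differentiableAt_of_smooth hg x).hasFDerivAt.rpow_const
    (p := r) (Or.inl (hpos x).ne')
  simp [dirDeriv, h.fderiv]

theorem dirDeriv_dirDeriv_rpow {g : E → ℝ} (hg : ContDiff ℝ (⊤ : ℕ∞) g) (hpos : ∀ x, 0 < g x)
    (r : ℝ) (v x : E) :
    dirDeriv v (dirDeriv v (fun x => g x ^ r)) x =
      r * (r - 1) * g x ^ (r - 2) * dirDeriv v g x ^ 2
        + r * g x ^ (r - 1) * dirDeriv v (dirDeriv v g) x := by
  rw [dirDeriv_rpow hg hpos]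
  have h1 := ((differentiableAt_of_smooth hg x).hasFDerivAt.rpow_const
    (p := r - 1) (Or.inl (hpos x).ne')).const_mul r
  have h2 := (differentiableAt_of_smooth (contDiff_dirDeriv hg v) x).hasFDerivAt
  have h := (h1.mul h2).fderiv
  have e : r - 1 - 1 = r - 2 := by ring
  simp only [dirDeriv] at h ⊢
  erw [h]
  simp [e]
  ring

theorem dirDeriv_add_const (g : E → F) (c : F) (v : E) :
    dirDeriv v (fun x => g x + c) = dirDeriv v g := by
  funext x
  simp [dirDeriv, fderiv_add_const]

theorem dirDeriv_inner {G : Type*} [NormedAddCommGroup G] [InnerProductSpace ℝ G] {u w : E → G}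
    (hu : ContDiff ℝ (⊤ : ℕ∞) u) (hw : ContDiff ℝ (⊤ : ℕ∞) w) (v : E) :
    dirDeriv v (fun x => inner ℝ (u x) (w x)) =
      fun x => inner ℝ (u x) (dirDeriv v w x) + inner ℝ (dirDeriv v u x) (w x) := by
  funext x
  exact fderiv_inner_apply ℝ (differentiableAt_of_smooth hu x) (differentiableAt_of_smooth hw x) v

theorem dirDeriv_norm_sq {G : Type*} [NormedAddCommGroup G] [InnerProductSpace ℝ G] {u : E → G}
    (hu : ContDiff ℝ (⊤ : ℕ∞) u) (v : E) :
    dirDeriv v (fun x => ‖u x‖ ^ 2) = fun x => 2 * inner ℝ (u x) (dirDeriv v u x) := by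
  simp_rw [← real_inner_self_eq_norm_sq]
  rw [dirDeriv_inner hu hu]
  funext x
  rw [real_inner_comm (u x)]
  ring

theorem dirDeriv_dirDeriv_norm_sq {G : Type*} [NormedAddCommGroup G] [InnerProductSpace ℝ G]
    {u : E → G} (hu : ContDiff ℝ (⊤ : ℕ∞) u) (v x : E) :
    dirDeriv v (dirDeriv v (fun x => ‖u x‖ ^ 2)) x =
      2 * (‖dirDeriv v u x‖ ^ 2 + inner ℝ (u x) (dirDeriv v (dirDeriv v u) x)) := by
  have hd := contDiff_dirDeriv hu v
  have h := congrFun (dirDeriv_inner hu hd v) x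
  have hdiff := differentiableAt_of_smooth (hu.inner ℝ hd) x
  rw [dirDeriv_norm_sq hu, ← real_inner_self_eq_norm_sq, add_comm (inner ℝ (dirDeriv v u x) _), ← h]
  simp only [dirDeriv] at hdiff ⊢
  rw [fderiv_const_mul hdiff]
  rfl

theorem integral_mul_dirDeriv_dirDeriv [MeasurableSpace E] [BorelSpace E] [FiniteDimensional ℝ E]
    {μ : Measure E} [μ.IsAddHaarMeasure] {V φ : E → ℝ} (hV : ContDiff ℝ (⊤ : ℕ∞) V)
    (hφ : ContDiff ℝ (⊤ : ℕ∞) φ) (hc : HasCompactSupport φ) (v : E) :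
    ∫ x, V x * dirDeriv v (dirDeriv v φ) x ∂μ = ∫ x, dirDeriv v (dirDeriv v V) x * φ x ∂μ := by
  have hV1 := contDiff_dirDeriv hV v
  have hV2 := contDiff_dirDeriv hV1 v
  have hφ1 := contDiff_dirDeriv hφ v
  have hφ2 := contDiff_dirDeriv hφ1 v
  have hc1 := hasCompactSupport_dirDeriv hc v
  have hc2 := hasCompactSupport_dirDeriv hc1 v
  have key : ∀ {a b : E → ℝ}, ContDiff ℝ (⊤ : ℕ∞) a → ContDiff ℝ (⊤ : ℕ∞) b →
      HasCompactSupport b → Integrable (fun x => a x * b x) μ := fun ha hb hb' =>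
    (ha.continuous.mul hb.continuous).integrable_of_hasCompactSupport hb'.mul_left
  have e1 := integral_mul_fderiv_eq_neg_fderiv_mul_of_integrable (v := v) (key hV1 hφ1 hc1)
    (key hV hφ2 hc2) (key hV hφ1 hc1) (fun x _ => differentiableAt_of_smooth hV x)
    (fun x _ => differentiableAt_of_smooth hφ1 x)
  have e2 := integral_mul_fderiv_eq_neg_fderiv_mul_of_integrable (v := v) (key hV2 hφ hc)
    (key hV1 hφ1 hc1) (key hV1 hφ hc) (fun x _ => differentiableAt_of_smooth hV1 x)
    (fun x _ => differentiableAt_of_smooth hφ x)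
  exact e1.trans (neg_eq_iff_eq_neg.2 e2)

/-- Kato-type inequality, one direction at a time. -/
theorem le_dirDeriv_dirDeriv_rpow_norm_sq_add {G : Type*} [NormedAddCommGroup G]
    [InnerProductSpace ℝ G] {u : E → G} (hu : ContDiff ℝ (⊤ : ℕ∞) u) {η q : ℝ} (hη : 0 < η)
    (hq : 1 / 2 < q) (v x : E) :
    2 * q * (‖u x‖ ^ 2 + η) ^ (q - 1) * inner ℝ (u x) (dirDeriv v (dirDeriv v u) x) ≤
      dirDeriv v (dirDeriv v (fun y => (‖u y‖ ^ 2 + η) ^ q)) x := by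
  have hpos : ∀ y, 0 < ‖u y‖ ^ 2 + η := fun y => by positivity
  rw [dirDeriv_dirDeriv_rpow ((hu.norm_sq ℝ).add contDiff_const) hpos, dirDeriv_add_const,
    dirDeriv_dirDeriv_norm_sq hu, dirDeriv_norm_sq hu]
  have e : (‖u x‖ ^ 2 + η) ^ (q - 1) = (‖u x‖ ^ 2 + η) ^ (q - 2) * (‖u x‖ ^ 2 + η) := by
    rw [← Real.rpow_add_one (hpos x).ne']
    ring_nf
  have hcs : inner ℝ (u x) (dirDeriv v u x) ^ 2 ≤ ‖u x‖ ^ 2 * ‖dirDeriv v u x‖ ^ 2 := by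
    rw [← mul_pow, ← sq_abs]
    exact pow_le_pow_left₀ (abs_nonneg _) (abs_real_inner_le_norm _ _) 2
  have hP : 0 < (‖u x‖ ^ 2 + η) ^ (q - 2) := Real.rpow_pos_of_pos (hpos x) _
  set I := inner ℝ (u x) (dirDeriv v u x)
  have hb : 0 ≤ 2 * (q - 1) * I ^ 2 + (‖u x‖ ^ 2 + η) * ‖dirDeriv v u x‖ ^ 2 := by
    nlinarith [mul_nonneg (by linarith : 0 ≤ 2 * q - 1) (sq_nonneg I),
      mul_nonneg hη.le (sq_nonneg ‖dirDeriv v u x‖)]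
  have := mul_nonneg (mul_nonneg (by linarith : 0 ≤ 2 * q) hP.le) hb
  rw [e]
  simp only
  linarith

end DirectionalDerivatives

section Laplacian

variable {N : ℕ} {F : Type*} [NormedAddCommGroup F] [NormedSpace ℝ F]

/-- The Laplacian on `ℝᴺ`. -/
noncomputable def lap (g : EuclideanSpace ℝ (Fin N) → F) : EuclideanSpace ℝ (Fin N) → F :=
  fun x => ∑ i : Fin N, dirDeriv (EuclideanSpace.single i 1) (dirDeriv (EuclideanSpace.single i 1) g) x

theorem contDiff_lap {g : EuclideanSpace ℝ (Fin N) → F} (hg : ContDiff ℝ (⊤ : ℕ∞) g) :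
    ContDiff ℝ (⊤ : ℕ∞) (lap g) :=
  ContDiff.sum fun _ _ => contDiff_dirDeriv (contDiff_dirDeriv hg _) _

theorem lap_eq_zero_of_notMem_tsupport {g : EuclideanSpace ℝ (Fin N) → F}
    {x : EuclideanSpace ℝ (Fin N)} (hx : x ∉ tsupport g) : lap g x = 0 :=
  Finset.sum_eq_zero fun _ _ => image_eq_zero_of_notMem_tsupport fun h =>
    hx (tsupport_fderiv_apply_subset ℝ _ (tsupport_fderiv_apply_subset ℝ _ h))

theorem hasCompactSupport_lap {g : EuclideanSpace ℝ (Fin N) → F} (hg : HasCompactSupport g) :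
    HasCompactSupport (lap g) :=
  HasCompactSupport.intro hg fun _ => lap_eq_zero_of_notMem_tsupport

theorem integral_mul_lap {V φ : EuclideanSpace ℝ (Fin N) → ℝ} (hV : ContDiff ℝ (⊤ : ℕ∞) V)
    (hφ : ContDiff ℝ (⊤ : ℕ∞) φ) (hc : HasCompactSupport φ) :
    ∫ x, V x * lap φ x = ∫ x, lap V x * φ x := by
  simp only [lap, Finset.mul_sum, Finset.sum_mul]
  rw [integral_finsetSum, integral_finsetSum]
  · exact Finset.sum_congr rfl fun i _ => integral_mul_dirDeriv_dirDeriv hV hφ hc _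
  · intro i _
    exact ((contDiff_dirDeriv (contDiff_dirDeriv hV _) _).continuous.mul
      hφ.continuous).integrable_of_hasCompactSupport hc.mul_left
  · intro i _
    exact (hV.continuous.mul
      (contDiff_dirDeriv (contDiff_dirDeriv hφ _) _).continuous).integrable_of_hasCompactSupport
      (hasCompactSupport_dirDeriv (hasCompactSupport_dirDeriv hc _) _).mul_left

/-- The regularised weight `(‖x‖² + δ)^{1 - a}` is superharmonic, quantitatively, when
`1 ≤ a`. -/
theorem lap_weight_le {δ a : ℝ} (hδ : 0 < δ) (ha : 1 ≤ a) (x : EuclideanSpace ℝ (Fin N)) :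
    lap (fun y : EuclideanSpace ℝ (Fin N) => (‖y‖ ^ 2 + δ) ^ (1 - a)) x ≤
      -(2 * (a - 1) * (N - 2 * a)) * (‖x‖ ^ 2 + δ) ^ (-a) := by
  have hpos : ∀ y : EuclideanSpace ℝ (Fin N), 0 < ‖y‖ ^ 2 + δ := fun y => by positivity
  have hid : ContDiff ℝ (⊤ : ℕ∞) (fun y : EuclideanSpace ℝ (Fin N) => y) := contDiff_id
  have hd : ∀ v : EuclideanSpace ℝ (Fin N),
      dirDeriv v (fun y : EuclideanSpace ℝ (Fin N) => y) = fun _ => v := fun v => by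
    funext y
    simp [dirDeriv]
  have hdd : ∀ v w : EuclideanSpace ℝ (Fin N),
      dirDeriv v (fun _ : EuclideanSpace ℝ (Fin N) => w) = fun _ => 0 := fun v w => by
    funext y
    simp [dirDeriv]
  have hterm : ∀ i : Fin N, dirDeriv (EuclideanSpace.single i 1) (dirDeriv (EuclideanSpace.single i 1)
      (fun y : EuclideanSpace ℝ (Fin N) => (‖y‖ ^ 2 + δ) ^ (1 - a))) x =
      (1 - a) * (-a) * (‖x‖ ^ 2 + δ) ^ (-1 - a) * (4 * ‖x i‖ ^ 2)
        + (1 - a) * (‖x‖ ^ 2 + δ) ^ (-a) * 2 := fun i => by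
    rw [dirDeriv_dirDeriv_rpow ((hid.norm_sq ℝ).add contDiff_const) hpos, dirDeriv_add_const,
      dirDeriv_dirDeriv_norm_sq hid, dirDeriv_norm_sq hid]
    simp only [hd, hdd]
    have e1 : 1 - a - 2 = -1 - a := by ring
    have e2 : 1 - a - 1 = -a := by ring
    have e3 : inner ℝ x (EuclideanSpace.single i (1 : ℝ)) = x i := by
      simp [EuclideanSpace.inner_single_right]
    have e4 : ‖EuclideanSpace.single i (1 : ℝ)‖ = 1 := by simp
    rw [e1, e2, e3, e4, inner_zero_right, Real.norm_eq_abs, sq_abs]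
    ring
  have hnorm : ∑ i, ‖x i‖ ^ 2 = ‖x‖ ^ 2 := (EuclideanSpace.norm_sq_eq x).symm
  have hsum : lap (fun y : EuclideanSpace ℝ (Fin N) => (‖y‖ ^ 2 + δ) ^ (1 - a)) x =
      (1 - a) * (-a) * (‖x‖ ^ 2 + δ) ^ (-1 - a) * (4 * ‖x‖ ^ 2)
        + N * ((1 - a) * (‖x‖ ^ 2 + δ) ^ (-a) * 2) := by
    simp only [lap, hterm, Finset.sum_add_distrib, ← Finset.mul_sum, hnorm]
    simp
    ring
  have e : (‖x‖ ^ 2 + δ) ^ (-a) = (‖x‖ ^ 2 + δ) ^ (-1 - a) * (‖x‖ ^ 2 + δ) := by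
    rw [← Real.rpow_add_one (hpos x).ne']
    ring_nf
  have hP : 0 < (‖x‖ ^ 2 + δ) ^ (-1 - a) := Real.rpow_pos_of_pos (hpos x) _
  rw [hsum, e]
  have := mul_nonneg (mul_nonneg (mul_nonneg (sub_nonneg.2 ha) (by linarith : 0 ≤ a)) hP.le) hδ.le
  nlinarith

theorem le_lap_rpow_norm_sq_add {u : EuclideanSpace ℝ (Fin N) → ℂ} (hu : ContDiff ℝ (⊤ : ℕ∞) u)
    {η p : ℝ} (hη : 0 < η) (hp : 1 < p) (x : EuclideanSpace ℝ (Fin N)) :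
    -(p * ((‖u x‖ ^ 2 + η) ^ ((p - 1) / 2) * ‖lap u x‖)) ≤
      lap (fun y => (‖u y‖ ^ 2 + η) ^ (p / 2) - η ^ (p / 2)) x := by
  have hpos : 0 < ‖u x‖ ^ 2 + η := by positivity
  have h1 : p * (‖u x‖ ^ 2 + η) ^ (p / 2 - 1) * inner ℝ (u x) (lap u x) ≤
      lap (fun y => (‖u y‖ ^ 2 + η) ^ (p / 2) - η ^ (p / 2)) x := by
    simp only [sub_eq_add_neg, lap, dirDeriv_add_const, inner_sum, Finset.mul_sum]
    refine Finset.sum_le_sum fun i _ => ?_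
    have := le_dirDeriv_dirDeriv_rpow_norm_sq_add hu hη (q := p / 2) (by linarith)
      (EuclideanSpace.single i 1) x
    rw [show 2 * (p / 2) = p by ring] at this
    exact this
  refine le_trans ?_ h1
  have h2 : -(‖u x‖ * ‖lap u x‖) ≤ inner ℝ (u x) (lap u x) :=
    (abs_le.1 (abs_real_inner_le_norm _ _)).1
  have h3 : ‖u x‖ ≤ (‖u x‖ ^ 2 + η) ^ (1 / 2 : ℝ) := by
    rw [← Real.sqrt_eq_rpow]
    exact Real.le_sqrt_of_sq_le (by linarith)
  have h4 : (‖u x‖ ^ 2 + η) ^ ((p - 1) / 2) =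
      (‖u x‖ ^ 2 + η) ^ (p / 2 - 1) * (‖u x‖ ^ 2 + η) ^ (1 / 2 : ℝ) := by
    rw [← Real.rpow_add hpos]
    ring_nf
  have hP : 0 < p * (‖u x‖ ^ 2 + η) ^ (p / 2 - 1) :=
    mul_pos (by linarith) (Real.rpow_pos_of_pos hpos _)
  have h5 : -((‖u x‖ ^ 2 + η) ^ (1 / 2 : ℝ) * ‖lap u x‖) ≤ inner ℝ (u x) (lap u x) :=
    le_trans (neg_le_neg (mul_le_mul_of_nonneg_right h3 (norm_nonneg _))) h2
  have := mul_le_mul_of_nonneg_left h5 hP.le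
  rw [h4]
  linarith

theorem contDiff_weight {δ : ℝ} (hδ : 0 < δ) (r : ℝ) :
    ContDiff ℝ (⊤ : ℕ∞) (fun x : EuclideanSpace ℝ (Fin N) => (‖x‖ ^ 2 + δ) ^ r) :=
  ((contDiff_id.norm_sq ℝ).add contDiff_const).rpow_const_of_ne fun x =>
    (show 0 < ‖x‖ ^ 2 + δ by positivity).ne'

theorem integral_weight_mul_regularised_le {u : EuclideanSpace ℝ (Fin N) → ℂ}
    (hu : ContDiff ℝ (⊤ : ℕ∞) u) (hc : HasCompactSupport u) {δ η a p : ℝ} (hδ : 0 < δ)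
    (hη : 0 < η) (hp : 1 < p) (ha : 1 ≤ a) :
    2 * (a - 1) * (N - 2 * a) *
        ∫ x, (‖x‖ ^ 2 + δ) ^ (-a) * ((‖u x‖ ^ 2 + η) ^ (p / 2) - η ^ (p / 2)) ≤
      p * ∫ x, (‖x‖ ^ 2 + δ) ^ (1 - a) * ((‖u x‖ ^ 2 + η) ^ ((p - 1) / 2) * ‖lap u x‖) := by
  set φ : EuclideanSpace ℝ (Fin N) → ℝ := fun x => (‖u x‖ ^ 2 + η) ^ (p / 2) - η ^ (p / 2) with hφd
  have hne : ∀ x, ‖u x‖ ^ 2 + η ≠ 0 := fun x => by positivity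
  have hg : ContDiff ℝ (⊤ : ℕ∞) (fun x => ‖u x‖ ^ 2 + η) := (hu.norm_sq ℝ).add contDiff_const
  have hφ : ContDiff ℝ (⊤ : ℕ∞) φ := (hg.rpow_const_of_ne hne).sub contDiff_const
  have hφc : HasCompactSupport φ := HasCompactSupport.intro hc fun x hx => by
    simp [φ, image_eq_zero_of_notMem_tsupport hx]
  have hφ0 : ∀ x, 0 ≤ φ x := fun x => sub_nonneg.2 <|
    Real.rpow_le_rpow hη.le (by nlinarith [sq_nonneg ‖u x‖]) (by linarith)
  have hV := contDiff_weight (N := N) hδ (1 - a)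
  have hW := contDiff_weight (N := N) hδ (-a)
  have hVpos : ∀ x : EuclideanSpace ℝ (Fin N), 0 < (‖x‖ ^ 2 + δ) ^ (1 - a) := fun x =>
    Real.rpow_pos_of_pos (by positivity) _
  have key := integral_mul_lap hV hφ hφc
  have hupper : ∫ x, lap (fun y : EuclideanSpace ℝ (Fin N) => (‖y‖ ^ 2 + δ) ^ (1 - a)) x * φ x ≤
      ∫ x, -(2 * (a - 1) * (N - 2 * a)) * ((‖x‖ ^ 2 + δ) ^ (-a) * φ x) := by
    refine integral_mono ?_ ?_ fun x => ?_
    · exact ((contDiff_lap hV).continuous.mul hφ.continuous).integrable_of_hasCompactSupport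
        hφc.mul_left
    · exact ((hW.continuous.mul hφ.continuous).integrable_of_hasCompactSupport
        hφc.mul_left).const_mul _
    · have := mul_le_mul_of_nonneg_right (lap_weight_le hδ ha x) (hφ0 x)
      rwa [mul_assoc] at this
  have hlower : ∫ x : EuclideanSpace ℝ (Fin N), -p * ((‖x‖ ^ 2 + δ) ^ (1 - a) *
      ((‖u x‖ ^ 2 + η) ^ ((p - 1) / 2) * ‖lap u x‖)) ≤
      ∫ x, (‖x‖ ^ 2 + δ) ^ (1 - a) * lap φ x := by
    refine integral_mono ?_ ?_ fun x => ?_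
    · exact ((hV.continuous.mul ((hg.rpow_const_of_ne hne).continuous.mul
        (contDiff_lap hu).continuous.norm)).integrable_of_hasCompactSupport
        (hasCompactSupport_lap hc).norm.mul_left.mul_left).const_mul _
    · exact (hV.continuous.mul (contDiff_lap hφ).continuous).integrable_of_hasCompactSupport
        (hasCompactSupport_lap hφc).mul_left
    · have := mul_le_mul_of_nonneg_left (le_lap_rpow_norm_sq_add hu hη hp x) (hVpos x).le
      simp only
      linarith
  rw [integral_const_mul] at hupper hlower
  linarith

theorem integral_weight_mul_rpow_norm_le {u : EuclideanSpace ℝ (Fin N) → ℂ}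
    (hu : ContDiff ℝ (⊤ : ℕ∞) u) (hc : HasCompactSupport u) {δ a p : ℝ} (hδ : 0 < δ)
    (hp : 1 < p) (ha : 1 ≤ a) :
    2 * (a - 1) * (N - 2 * a) * ∫ x, (‖x‖ ^ 2 + δ) ^ (-a) * ‖u x‖ ^ p ≤
      p * ∫ x, (‖x‖ ^ 2 + δ) ^ (1 - a) * (‖u x‖ ^ (p - 1) * ‖lap u x‖) := by
  let A : ℝ → EuclideanSpace ℝ (Fin N) → ℝ := fun t x =>
    (‖x‖ ^ 2 + δ) ^ (-a) * ((‖u x‖ ^ 2 + t ^ 2) ^ (p / 2) - (t ^ 2) ^ (p / 2))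
  let B : ℝ → EuclideanSpace ℝ (Fin N) → ℝ := fun t x =>
    (‖x‖ ^ 2 + δ) ^ (1 - a) * ((‖u x‖ ^ 2 + t ^ 2) ^ ((p - 1) / 2) * ‖lap u x‖)
  have hV := (contDiff_weight (N := N) hδ (1 - a)).continuous
  have hW := (contDiff_weight (N := N) hδ (-a)).continuous
  have hL := (contDiff_lap hu).continuous
  have hu' := hu.continuous
  have hs : Continuous fun z : ℝ × EuclideanSpace ℝ (Fin N) => ‖u z.2‖ ^ 2 + z.1 ^ 2 := by fun_prop
  have ht : Continuous fun z : ℝ × EuclideanSpace ℝ (Fin N) => z.1 ^ 2 := by fun_prop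
  have hA : Continuous A.uncurry := (hW.comp continuous_snd).mul
    ((hs.rpow_const fun _ => Or.inr (by linarith)).sub
      (ht.rpow_const fun _ => Or.inr (by linarith)))
  have hB : Continuous B.uncurry := (hV.comp continuous_snd).mul
    ((hs.rpow_const fun _ => Or.inr (by linarith)).mul (hL.comp continuous_snd).norm)
  have hA0 : ∀ t, ∫ x in tsupport u, A t x = ∫ x, A t x := fun t =>
    setIntegral_eq_integral_of_forall_compl_eq_zero fun x hx => by
      simp [A, image_eq_zero_of_notMem_tsupport hx]
  have hB0 : ∀ t, ∫ x in tsupport u, B t x = ∫ x, B t x := fun t =>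
    setIntegral_eq_integral_of_forall_compl_eq_zero fun x hx => by
      simp [B, lap_eq_zero_of_notMem_tsupport hx]
  have cA : Continuous fun t => ∫ x, A t x := by
    simp_rw [← hA0]
    exact continuous_parametric_integral_of_continuous hA hc
  have cB : Continuous fun t => ∫ x, B t x := by
    simp_rw [← hB0]
    exact continuous_parametric_integral_of_continuous hB hc
  have hlim : 2 * (a - 1) * (N - 2 * a) * ∫ x, A 0 x ≤ p * ∫ x, B 0 x := by
    have tA := ((cA.tendsto 0).mono_left (nhdsWithin_le_nhds (s := Set.Ioi 0))).const_mul
      (2 * (a - 1) * (N - 2 * a))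
    have tB := ((cB.tendsto 0).mono_left (nhdsWithin_le_nhds (s := Set.Ioi 0))).const_mul p
    refine le_of_tendsto_of_tendsto tA tB ?_
    filter_upwards [self_mem_nhdsWithin] with t ht0
    exact integral_weight_mul_regularised_le hu hc hδ (pow_pos ht0 2) hp ha
  have hpow : ∀ (s r : ℝ), 0 ≤ s → (s ^ 2) ^ (r / 2) = s ^ r := fun s r h0 => by
    rw [← Real.rpow_natCast, ← Real.rpow_mul h0]
    congr 1
    push_cast
    ring
  have hzero : (0 : ℝ) ^ (p / 2) = 0 := Real.zero_rpow (by linarith)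
  simpa [A, B, hpow _ _ (norm_nonneg _), hzero] using hlim

theorem rpow_sub_one_mul_le {x y l p : ℝ} (hx : 0 ≤ x) (hy : 0 ≤ y) (hl : 0 < l) (hp : 1 < p) :
    x ^ (p - 1) * y ≤ l * x ^ p + l ^ (1 - p) * y ^ p := by
  have split : ∀ {z : ℝ}, 0 ≤ z → z ^ p = z ^ (p - 1) * z := fun {z} hz => by
    rcases hz.eq_or_lt with rfl | hz
    · simp [Real.zero_rpow (by linarith : p ≠ 0)]
    · rw [← Real.rpow_add_one hz.ne', sub_add_cancel]
  have hxp := Real.rpow_nonneg hx p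
  have hx1 := Real.rpow_nonneg hx (p - 1)
  have hyp := Real.rpow_nonneg hy p
  have hlp := Real.rpow_nonneg hl.le (1 - p)
  rcases le_total y (l * x) with h | h
  · have h1 := mul_le_mul_of_nonneg_left h hx1
    rw [split hx]
    nlinarith [mul_nonneg hlp hyp]
  · have h1 : x ≤ y / l := (le_div_iff₀ hl).2 (by linarith)
    have h2 := mul_le_mul_of_nonneg_right (Real.rpow_le_rpow hx h1 (by linarith : 0 ≤ p - 1)) hy
    have h3 : (y / l) ^ (p - 1) * y = l ^ (1 - p) * y ^ p := by
      rw [Real.div_rpow hy hl.le, split hy, show 1 - p = -(p - 1) by ring, Real.rpow_neg hl.le]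
      field_simp
    rw [h3] at h2
    nlinarith [mul_nonneg hl.le hxp]

/-- Weighted second-order Rellich inequality with regularised weights; the constant does not
depend on the regularisation parameter. -/
theorem exists_weighted_rellich {a p : ℝ} (hp : 1 < p) (ha : 1 < a) (haN : 2 * a < N) :
    ∃ C : ℝ, 0 < C ∧ ∀ δ : ℝ, 0 < δ → ∀ u : EuclideanSpace ℝ (Fin N) → ℂ,
      ContDiff ℝ (⊤ : ℕ∞) u → HasCompactSupport u →
      ∫ x, (‖x‖ ^ 2 + δ) ^ (-a) * ‖u x‖ ^ p ≤
        C * ∫ x, (‖x‖ ^ 2 + δ) ^ (p - a) * ‖lap u x‖ ^ p := by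
  set c : ℝ := 2 * (a - 1) * (N - 2 * a) with hcdef
  have hcpos : 0 < c := mul_pos (by linarith) (by linarith)
  set l : ℝ := c / (2 * p) with hldef
  have hl : 0 < l := by positivity
  have hlp : p * l = c / 2 := by
    rw [hldef]
    field_simp
  refine ⟨2 / c * (p * l ^ (1 - p)), by positivity, fun δ hδ u hu hc => ?_⟩
  have main := integral_weight_mul_rpow_norm_le hu hc hδ hp ha.le
  have hcu : Continuous fun x => ‖u x‖ ^ p :=
    hu.continuous.norm.rpow_const fun _ => Or.inr (by linarith)
  have hcu1 : Continuous fun x => ‖u x‖ ^ (p - 1) :=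
    hu.continuous.norm.rpow_const fun _ => Or.inr (by linarith)
  have hcL := (contDiff_lap hu).continuous.norm
  have hcLp : Continuous fun x => ‖lap u x‖ ^ p := hcL.rpow_const fun _ => Or.inr (by linarith)
  have hsu : HasCompactSupport fun x => ‖u x‖ ^ p :=
    hc.comp_left (g := fun z : ℂ => ‖z‖ ^ p) (by simp [Real.zero_rpow (by linarith : p ≠ 0)])
  have hsL : HasCompactSupport fun x => ‖lap u x‖ ^ p :=
    (hasCompactSupport_lap hc).comp_left (g := fun z : ℂ => ‖z‖ ^ p)
      (by simp [Real.zero_rpow (by linarith : p ≠ 0)])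
  have hI1 : Integrable fun x => (‖x‖ ^ 2 + δ) ^ (-a) * ‖u x‖ ^ p :=
    ((contDiff_weight hδ _).continuous.mul hcu).integrable_of_hasCompactSupport hsu.mul_left
  have hI2 : Integrable fun x => (‖x‖ ^ 2 + δ) ^ (p - a) * ‖lap u x‖ ^ p :=
    ((contDiff_weight hδ _).continuous.mul hcLp).integrable_of_hasCompactSupport hsL.mul_left
  have hI3 : Integrable fun x => (‖x‖ ^ 2 + δ) ^ (1 - a) * (‖u x‖ ^ (p - 1) * ‖lap u x‖) :=
    ((contDiff_weight hδ _).continuous.mul (hcu1.mul hcL)).integrable_of_hasCompactSupport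
      (hasCompactSupport_lap hc).norm.mul_left.mul_left
  have hyoung : ∫ x, (‖x‖ ^ 2 + δ) ^ (1 - a) * (‖u x‖ ^ (p - 1) * ‖lap u x‖) ≤
      ∫ x, (l * ((‖x‖ ^ 2 + δ) ^ (-a) * ‖u x‖ ^ p) +
        l ^ (1 - p) * ((‖x‖ ^ 2 + δ) ^ (p - a) * ‖lap u x‖ ^ p)) := by
    refine integral_mono hI3 ((hI1.const_mul _).add (hI2.const_mul _)) fun x => ?_
    have hpos : 0 < ‖x‖ ^ 2 + δ := by positivity
    have h := mul_le_mul_of_nonneg_left (rpow_sub_one_mul_le (norm_nonneg (u x))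
      (mul_nonneg hpos.le (norm_nonneg (lap u x))) hl hp) (Real.rpow_nonneg hpos.le (-a))
    have e1 : (‖x‖ ^ 2 + δ) ^ (1 - a) = (‖x‖ ^ 2 + δ) ^ (-a) * (‖x‖ ^ 2 + δ) := by
      rw [← Real.rpow_add_one hpos.ne']
      ring_nf
    have e2 : (‖x‖ ^ 2 + δ) ^ (p - a) = (‖x‖ ^ 2 + δ) ^ (-a) * (‖x‖ ^ 2 + δ) ^ p := by
      rw [← Real.rpow_add hpos]
      ring_nf
    rw [Real.mul_rpow hpos.le (norm_nonneg _)] at h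
    simp only [e1, e2]
    linarith
  rw [integral_add (hI1.const_mul _) (hI2.const_mul _), integral_const_mul,
    integral_const_mul] at hyoung
  have h1 := main.trans (mul_le_mul_of_nonneg_left hyoung (by linarith : 0 ≤ p))
  set I := ∫ x, (‖x‖ ^ 2 + δ) ^ (-a) * ‖u x‖ ^ p
  set J := ∫ x, (‖x‖ ^ 2 + δ) ^ (p - a) * ‖lap u x‖ ^ p
  have h2 : c / 2 * I ≤ p * l ^ (1 - p) * J := by
    have : p * (l * I + l ^ (1 - p) * J) = c / 2 * I + p * l ^ (1 - p) * J := by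
      rw [← hlp]
      ring
    linarith
  have h3 := mul_le_mul_of_nonneg_left h2 (by positivity : 0 ≤ 2 / c)
  rw [show 2 / c * (c / 2 * I) = I by field_simp] at h3
  linarith

end Laplacian

section Polyharmonic

variable {N : ℕ}

theorem negLapPow_zero (f : EuclideanSpace ℝ (Fin N) → ℂ) : negLapPow 0 f = f := rfl

theorem negLapPow_succ (m : ℕ) (f : EuclideanSpace ℝ (Fin N) → ℂ) :
    negLapPow (m + 1) f = negLapPow m (-lap f) := rfl

theorem contDiff_negLapPow (m : ℕ) {f : EuclideanSpace ℝ (Fin N) → ℂ}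
    (hf : ContDiff ℝ (⊤ : ℕ∞) f) : ContDiff ℝ (⊤ : ℕ∞) (negLapPow m f) := by
  induction m generalizing f with
  | zero => exact hf
  | succ m ih => exact ih (contDiff_lap hf).neg

theorem hasCompactSupport_negLapPow (m : ℕ) {f : EuclideanSpace ℝ (Fin N) → ℂ}
    (hf : HasCompactSupport f) : HasCompactSupport (negLapPow m f) := by
  induction m generalizing f with
  | zero => exact hf
  | succ m ih => exact ih (hasCompactSupport_lap hf).neg

theorem exists_regularised_rellich {p : ℝ} (hp : 1 < p) (m : ℕ) (hm : 2 * m * p < N) :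
    ∃ K : ℝ, 0 < K ∧ ∀ δ : ℝ, 0 < δ → ∀ f : EuclideanSpace ℝ (Fin N) → ℂ,
      ContDiff ℝ (⊤ : ℕ∞) f → HasCompactSupport f →
      ∫ x, (‖x‖ ^ 2 + δ) ^ (-(m * p)) * ‖f x‖ ^ p ≤ K * ∫ x, ‖negLapPow m f x‖ ^ p := by
  induction m with
  | zero => exact ⟨1, one_pos, fun δ _ f _ _ => by simp [negLapPow_zero]⟩
  | succ m ih =>
    push_cast at hm
    obtain ⟨K, hK, hK'⟩ := ih (by linarith)
    have hmp : 0 ≤ (m : ℝ) * p := by positivity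
    obtain ⟨C, hC, hC'⟩ := exists_weighted_rellich (N := N) (a := ((m + 1 : ℕ) : ℝ) * p) hp
      (by push_cast; linarith) (by push_cast; linarith)
    refine ⟨C * K, mul_pos hC hK, fun δ hδ f hf hc => (hC' δ hδ f hf hc).trans ?_⟩
    have h := hK' δ hδ (-lap f) (contDiff_lap hf).neg (hasCompactSupport_lap hc).neg
    have e : p - ((m + 1 : ℕ) : ℝ) * p = -(m * p) := by
      push_cast
      ring
    rw [e, mul_assoc, negLapPow_succ]
    refine mul_le_mul_of_nonneg_left ?_ hC.le
    simpa using h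

theorem lintegral_weight_le {p : ℝ} (hp : 1 < p) {m : ℕ} (hm : 1 ≤ m) {K : ℝ}
    {f g : EuclideanSpace ℝ (Fin N) → ℂ} (hf : Continuous f) (hfc : HasCompactSupport f)
    (hg : Continuous g) (hgc : HasCompactSupport g) (hK : 0 ≤ K)
    (h : ∀ δ : ℝ, 0 < δ →
      ∫ x, (‖x‖ ^ 2 + δ) ^ (-(m * p)) * ‖f x‖ ^ p ≤ K * ∫ x, ‖g x‖ ^ p) :
    ∫⁻ x, ‖((‖x‖ ^ (-(2 * (m : ℝ))) : ℝ) : ℂ) * f x‖ₑ ^ p ≤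
      ENNReal.ofReal K * ∫⁻ x, ‖g x‖ₑ ^ p := by
  have hp0 : 0 < p := by linarith
  have enorm_rpow : ∀ z : ℂ, ‖z‖ₑ ^ p = ENNReal.ofReal (‖z‖ ^ p) := fun z => by
    rw [← ofReal_norm, ENNReal.ofReal_rpow_of_nonneg (norm_nonneg _) hp0.le]
  have rpow_supp : ∀ {w : EuclideanSpace ℝ (Fin N) → ℂ}, HasCompactSupport w →
      HasCompactSupport fun x => ‖w x‖ ^ p := fun hw =>
    hw.comp_left (g := fun z : ℂ => ‖z‖ ^ p) (by simp [Real.zero_rpow hp0.ne'])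
  let δ : ℕ → ℝ := fun n => 1 / ((n : ℝ) + 1)
  have hδ : ∀ n, 0 < δ n := fun n => Nat.one_div_pos_of_nat
  have hδ0 : Tendsto δ atTop (𝓝 0) := tendsto_one_div_add_atTop_nhds_zero_nat
  let G : ℕ → EuclideanSpace ℝ (Fin N) → ℝ := fun n x =>
    (‖x‖ ^ 2 + δ n) ^ (-(m * p)) * ‖f x‖ ^ p
  have hGc : ∀ n, Continuous (G n) := fun n => (contDiff_weight (hδ n) _).continuous.mul
    (hf.norm.rpow_const fun _ => Or.inr hp0.le)
  have hG0 : ∀ n x, 0 ≤ G n x := fun n x => by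
    have := hδ n
    positivity
  have hGi : ∀ n, Integrable (G n) := fun n =>
    (hGc n).integrable_of_hasCompactSupport (rpow_supp hfc).mul_left
  have hgi : Integrable fun x => ‖g x‖ ^ p :=
    (hg.norm.rpow_const fun _ => Or.inr hp0.le).integrable_of_hasCompactSupport (rpow_supp hgc)
  have hright : ENNReal.ofReal K * ∫⁻ x, ‖g x‖ₑ ^ p =
      ENNReal.ofReal (K * ∫ x, ‖g x‖ ^ p) := by
    rw [ENNReal.ofReal_mul hK, ofReal_integral_eq_lintegral_ofReal hgi
      (ae_of_all _ fun x => by positivity)]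
    simp_rw [enorm_rpow]
  have hbound : ∀ n, ∫⁻ x, ENNReal.ofReal (G n x) ≤ ENNReal.ofReal (K * ∫ x, ‖g x‖ ^ p) :=
    fun n => by
      rw [← ofReal_integral_eq_lintegral_ofReal (hGi n) (ae_of_all _ (hG0 n))]
      exact ENNReal.ofReal_le_ofReal (h _ (hδ n))
  have hpoint : ∀ x : EuclideanSpace ℝ (Fin N),
      ‖((‖x‖ ^ (-(2 * (m : ℝ))) : ℝ) : ℂ) * f x‖ₑ ^ p ≤
        liminf (fun n => ENNReal.ofReal (G n x)) atTop := fun x => by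
    have hm0 : (m : ℝ) ≠ 0 := by positivity
    rcases eq_or_ne x 0 with rfl | hx
    · have : (0 : ℝ) ^ (-(2 * (m : ℝ))) = 0 := Real.zero_rpow (by simpa using hm0)
      simp [this, hp0]
    · have hlim : Tendsto (fun n => G n x) atTop (𝓝 ((‖x‖ ^ 2 + 0) ^ (-(m * p)) * ‖f x‖ ^ p)) :=
        ((tendsto_const_nhds.add hδ0).rpow_const (Or.inl (by simpa using hx))).mul_const _
      rw [(ENNReal.tendsto_ofReal hlim).liminf_eq, enorm_rpow, norm_mul,
        Complex.norm_real, Real.norm_of_nonneg (by positivity),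
        Real.mul_rpow (by positivity) (by positivity), ← Real.rpow_mul (norm_nonneg x), add_zero,
        ← Real.rpow_natCast, ← Real.rpow_mul (norm_nonneg x)]
      apply le_of_eq
      congr 3
      push_cast
      ring
  rw [hright]
  calc _ ≤ ∫⁻ x, liminf (fun n => ENNReal.ofReal (G n x)) atTop := lintegral_mono hpoint
    _ ≤ liminf (fun n => ∫⁻ x, ENNReal.ofReal (G n x)) atTop :=
      lintegral_liminf_le fun n => (hGc n).measurable.ennreal_ofReal
    _ ≤ liminf (fun _ : ℕ => ENNReal.ofReal (K * ∫ x, ‖g x‖ ^ p)) atTop :=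
      liminf_le_liminf (Eventually.of_forall hbound)
    _ = _ := liminf_const _

end Polyharmonic


/-- the `L^p` Rellich inequality of Davies–Hinz: for `N > 2m` and
`1 < p < N/(2m)` there exists `K(m,N,p) > 0` with
`‖ |x|^{-2m} f ‖_{L^p} ≤ K(m,N,p) ‖ (-Δ)^m f ‖_{L^p}` for every smooth compactly
supported `f` whose support avoids the origin. -/
theorem stmt_13 (m N : ℕ) (hm : 1 ≤ m) (hN : 2 * m < N)
    (p : ℝ) (hp1 : 1 < p) (hp2 : p < (N : ℝ) / (2 * m)) :
    ∃ K : ℝ, 0 < K ∧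
      ∀ f : EuclideanSpace ℝ (Fin N) → ℂ,
        ContDiff ℝ (⊤ : ℕ∞) f → HasCompactSupport f → (0 : EuclideanSpace ℝ (Fin N)) ∉ tsupport f →
        eLpNorm (fun x => (‖x‖ ^ (-(2 * (m : ℝ))) : ℝ) * f x)
            (ENNReal.ofReal p) volume ≤
          ENNReal.ofReal K * eLpNorm (negLapPow m f) (ENNReal.ofReal p) volume := by
  have hp0 : 0 < p := by linarith
  have hm0 : (0 : ℝ) < 2 * m := by positivity
  obtain ⟨K, hK, hK'⟩ := exists_regularised_rellich (N := N) hp1 m (by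
    rw [lt_div_iff₀ hm0] at hp2
    linarith)
  refine ⟨K ^ (1 / p), Real.rpow_pos_of_pos hK _, fun f hf hc _ => ?_⟩
  have h := lintegral_weight_le hp1 hm hf.continuous hc (contDiff_negLapPow m hf).continuous
    (hasCompactSupport_negLapPow m hc) hK.le fun δ hδ => hK' δ hδ f hf hc
  have hne : ENNReal.ofReal p ≠ 0 := (ENNReal.ofReal_pos.2 hp0).ne'
  rw [eLpNorm_eq_lintegral_rpow_enorm_toReal hne ENNReal.ofReal_ne_top,
    eLpNorm_eq_lintegral_rpow_enorm_toReal hne ENNReal.ofReal_ne_top, ENNReal.toReal_ofReal hp0.le,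
    ← ENNReal.ofReal_rpow_of_pos hK, ← ENNReal.mul_rpow_of_nonneg _ _ (by positivity)]
  exact ENNReal.rpow_le_rpow h (by positivity)
end
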